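/- arXiv:1604.00216 — 2 statements merged into one kernel-verified Lean document; each statement's English description precedes it below -/
import Mathlib

section
/- If U is a universal prefix-free machine and X is a nonempty Π⁰₁ set, then the number Ω_U(X) is a Martin-Löf random left-c.e. real. -/
open Filter MeasureTheory Set

/-- A real is left-c.e. if it is the limit of a computable increasing sequence of rationals. -/
def LeftCE (x : ℝ) : Prop :=
  ∃ f : ℕ → ℚ, Computable f ∧ Monotone f ∧
    Tendsto (fun n => (f n : ℝ)) atTop (nhds x)

/-- A real is right-c.e. if it is the limit of a computable decreasing sequence of rationals. -/
def RightCE (x : ℝ) : Prop :=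
  ∃ f : ℕ → ℚ, Computable f ∧ Antitone f ∧
    Tendsto (fun n => (f n : ℝ)) atTop (nhds x)

/-- The Σ⁰₁ class of reals given by level `i` of the computable enumeration `g` of
rational open intervals. -/
def testSet (g : ℕ → ℕ → ℚ × ℚ) (i : ℕ) : Set ℝ :=
  ⋃ n, Set.Ioo (((g i n).1 : ℝ)) (((g i n).2 : ℝ))

/-- A real is Martin-Löf random if for every Martin-Löf test, i.e. every uniformly c.e.
sequence of Σ⁰₁ classes `(U_i)` with `μ(U_i) ≤ 2⁻¹ ^ i`, the real avoids some level of
the test. -/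
def MLRandom (x : ℝ) : Prop :=
  ∀ g : ℕ → ℕ → ℚ × ℚ, Computable₂ g →
    (∀ i, volume (testSet g i) ≤ 2⁻¹ ^ i) →
    ∃ i, x ∉ testSet g i

/-- A partial function on binary strings has prefix-free domain if no element of the
domain is a proper prefix of another. -/
def PrefixFreeDomain (M : List Bool →. List Bool) : Prop :=
  ∀ σ τ : List Bool, σ <+: τ → (M σ).Dom → (M τ).Dom → σ = τ

/-- A prefix-free machine is a partial computable function from binary strings to binary
strings whose domain is prefix-free. -/
def PrefixFreeMachine (M : List Bool →. List Bool) : Prop :=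
  Partrec M ∧ PrefixFreeDomain M

/-- A prefix-free machine `U` is universal if for every effective list `(M_e)` of
prefix-free machines there is a computable function `e ↦ σ_e` such that
`U (σ_e * τ) ≃ M_e τ` for all strings `τ`. -/
def UniversalPFM (U : List Bool →. List Bool) : Prop :=
  PrefixFreeMachine U ∧
    ∀ M : ℕ → List Bool →. List Bool, Partrec₂ M →
      (∀ e, PrefixFreeDomain (M e)) →
      ∃ g : ℕ → List Bool, Computable g ∧ ∀ e τ, U (g e ++ τ) = M e τ

/-- A predicate is computably enumerable. -/
def CEPred {α : Type*} [Primcodable α] (p : α → Prop) : Prop :=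
  Partrec fun a => Part.assert (p a) fun _ => Part.some ()

/-- A set of binary strings is Π⁰₁ if its complement is computably enumerable. -/
def Pi01 (X : Set (List Bool)) : Prop := CEPred fun σ => σ ∉ X

/-- `Omega U X` is the probability that the prefix-free machine `U` halts and outputs
an element of `X`, i.e. `Ω_U(X) = Σ_{U(σ)↓ ∈ X} 2^{-|σ|}`. -/
noncomputable def Omega (U : List Bool →. List Bool) (X : Set (List Bool)) : ℝ :=
  ∑' σ : {σ : List Bool // ∃ y ∈ U σ, y ∈ X}, (2 : ℝ)⁻¹ ^ (σ : List Bool).length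


namespace OmegaPf

theorem cp_and {α : Type*} [Primcodable α] {p q : α → Prop} (hp : ComputablePred p)
    (hq : ComputablePred q) : ComputablePred fun a => p a ∧ q a := by
  obtain ⟨f, hf, rfl⟩ := ComputablePred.computable_iff.1 hp
  obtain ⟨g, hg, rfl⟩ := ComputablePred.computable_iff.1 hq
  refine ComputablePred.computable_iff.2 ⟨fun a => f a && g a, Primrec.and.to_comp.comp hf hg, ?_⟩
  funext a; simp

theorem cp_or {α : Type*} [Primcodable α] {p q : α → Prop} (hp : ComputablePred p)
    (hq : ComputablePred q) : ComputablePred fun a => p a ∨ q a := by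
  obtain ⟨f, hf, rfl⟩ := ComputablePred.computable_iff.1 hp
  obtain ⟨g, hg, rfl⟩ := ComputablePred.computable_iff.1 hq
  refine ComputablePred.computable_iff.2 ⟨fun a => f a || g a, Primrec.or.to_comp.comp hf hg, ?_⟩
  funext a; simp

theorem cp_comp {α β : Type*} [Primcodable α] [Primcodable β] {p : β → Prop}
    (hp : ComputablePred p) {f : α → β} (hf : Computable f) : ComputablePred fun a => p (f a) := by
  obtain ⟨g, hg, rfl⟩ := ComputablePred.computable_iff.1 hp
  exact ComputablePred.computable_iff.2 ⟨_, hg.comp hf, rfl⟩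

theorem c_ite {α β : Type*} [Primcodable α] [Primcodable β] {p : α → Prop} [DecidablePred p]
    (hp : ComputablePred p) {f g : α → β} (hf : Computable f) (hg : Computable g) :
    Computable fun a => if p a then f a else g a := by
  simpa [Bool.cond_decide] using hp.decide.cond hf hg

theorem cp_le {α : Type*} [Primcodable α] {f g : α → ℕ} (hf : Computable f) (hg : Computable g) :
    ComputablePred fun a => f a ≤ g a :=
  cp_comp (p := fun x : ℕ × ℕ => x.1 ≤ x.2) (PrimrecPred.computablePred Primrec.nat_le) (hf.pair hg)

theorem cp_lt {α : Type*} [Primcodable α] {f g : α → ℕ} (hf : Computable f) (hg : Computable g) :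
    ComputablePred fun a => f a < g a :=
  cp_comp (p := fun x : ℕ × ℕ => x.1 < x.2) (PrimrecPred.computablePred Primrec.nat_lt) (hf.pair hg)

theorem cp_eq {α β : Type*} [Primcodable α] [Primcodable β] {f g : α → β}
    (hf : Computable f) (hg : Computable g) :
    ComputablePred fun a => f a = g a := by
  classical
  exact cp_comp (p := fun x : β × β => x.1 = x.2) (PrimrecPred.computablePred Primrec.eq)
    (hf.pair hg)

theorem c_add {α : Type*} [Primcodable α] {f g : α → ℕ} (hf : Computable f) (hg : Computable g) :
    Computable fun a => f a + g a := Primrec.nat_add.to_comp.comp hf hg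
theorem c_sub {α : Type*} [Primcodable α] {f g : α → ℕ} (hf : Computable f) (hg : Computable g) :
    Computable fun a => f a - g a := Primrec.nat_sub.to_comp.comp hf hg
theorem c_mul {α : Type*} [Primcodable α] {f g : α → ℕ} (hf : Computable f) (hg : Computable g) :
    Computable fun a => f a * g a := Primrec.nat_mul.to_comp.comp hf hg
theorem c_div {α : Type*} [Primcodable α] {f g : α → ℕ} (hf : Computable f) (hg : Computable g) :
    Computable fun a => f a / g a := Primrec.nat_div.to_comp.comp hf hg
theorem c_mod {α : Type*} [Primcodable α] {f g : α → ℕ} (hf : Computable f) (hg : Computable g) :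
    Computable fun a => f a % g a := Primrec.nat_mod.to_comp.comp hf hg

theorem ofNat_comp (s : Set ℕ) [DecidablePred (· ∈ s)] [Infinite s]
    (hs : ComputablePred (· ∈ s)) : Computable fun n => (Nat.Subtype.ofNat s n : ℕ) := by
  classical
  have hex : ∀ x : ℕ, ∃ n, x + n + 1 ∈ s := by
    intro x
    have : s.Infinite := Set.infinite_coe_iff.1 inferInstance
    obtain ⟨y, hy, hxy⟩ := this.exists_gt x
    exact ⟨y - x - 1, by rwa [show x + (y - x - 1) + 1 = y by omega]⟩
  have hf : Computable (fun x => Nat.find (hex x)) := by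
    apply Computable.find
    exact cp_comp hs (Computable.succ.comp (c_add Computable.fst Computable.snd))
  have : Computable fun n : ℕ => (Nat.rec (Nat.Subtype.ofNat s 0 : ℕ)
      (fun _ y => y + Nat.find (hex y) + 1) n : ℕ) := by
    refine Computable.nat_rec (f := fun n : ℕ => n) (g := fun _ => (Nat.Subtype.ofNat s 0 : ℕ))
       (h := fun _ p => p.2 + Nat.find (hex p.2) + 1) Computable.id (Computable.const _) ?_
    have h2 : Computable fun p : ℕ × ℕ × ℕ => p.2.2 := Computable.snd.comp Computable.snd
    exact Computable.succ.comp (c_add h2 (hf.comp h2))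
  refine this.of_eq fun n => ?_
  induction n with
  | zero => rfl
  | succ n ih =>
    simp only [ih]
    show _ = ((Nat.Subtype.succ (Nat.Subtype.ofNat s n) : s) : ℕ)
    unfold Nat.Subtype.succ
    rfl

/-- raw code -/
def raw (q : ℚ) : ℕ := @Encodable.encode ℚ Rat.instEncodable q

theorem raw_eq (q : ℚ) : raw q = Nat.pair (Encodable.encode q.num) q.den := rfl

theorem enc_int (z : ℤ) : Encodable.encode z = if 0 ≤ z then 2 * z.toNat else 2 * (-z).toNat - 1 := by
  rcases z with n | n
  · simp; rfl
  · have : ¬ (0 ≤ Int.negSucc n) := by simp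
    rw [if_neg this]
    have h2 : (-Int.negSucc n).toNat = n + 1 := by rfl
    rw [h2]
    show 2 * n + 1 = _
    omega

theorem raw_range : Set.range raw = {k | 0 < (Nat.unpair k).2 ∧
    ((Nat.unpair k).1 + 1) / 2 = ((Nat.unpair k).1 + 1) / 2 ∧
    ∀ x < (Nat.unpair k).2 + 1, 
      (x = 1 ∨ ¬ ((((Nat.unpair k).1 + 1) / 2) % x = 0 ∧ (Nat.unpair k).2 % x = 0))} := by
  have key : ∀ z : ℤ, (Encodable.encode z + 1) / 2 = z.natAbs := by
    intro z; rw [enc_int]; split_ifs <;> omega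
  ext k
  simp only [Set.mem_range, Set.mem_ofPred_eq, true_and]
  have cop : ∀ a d : ℕ, 0 < d → (a.Coprime d ↔
      ∀ x < d + 1, x = 1 ∨ ¬ (a % x = 0 ∧ d % x = 0)) := by
    intro a d hd
    constructor
    · intro h x hx
      by_contra! hc
      refine hc.1 (Nat.dvd_one.1 ?_)
      rw [← Nat.Coprime.gcd_eq_one h]
      exact Nat.dvd_gcd (Nat.dvd_of_mod_eq_zero hc.2.1) (Nat.dvd_of_mod_eq_zero hc.2.2)
    · intro h
      have := h (Nat.gcd a d) (Nat.lt_succ_of_le (Nat.le_of_dvd hd (Nat.gcd_dvd_right _ _)))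
      rcases this with h | h
      · exact h
      · exact absurd ⟨Nat.mod_eq_zero_of_dvd (Nat.gcd_dvd_left _ _),
          Nat.mod_eq_zero_of_dvd (Nat.gcd_dvd_right _ _)⟩ h
  constructor
  · rintro ⟨q, rfl⟩
    rw [raw_eq, Nat.unpair_pair]
    refine ⟨q.pos, ?_⟩
    simp only [key]
    exact (cop _ _ q.pos).1 q.reduced
  · rintro ⟨h1, h2⟩
    have h3 := (cop _ _ h1).2 h2
    obtain ⟨z, hz⟩ := (Denumerable.eqv ℤ).surjective (Nat.unpair k).1
    have hz' : Encodable.encode z = (Nat.unpair k).1 := hz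
    rw [← hz', key] at h3
    refine ⟨⟨z, (Nat.unpair k).2, h1.ne', h3⟩, ?_⟩
    rw [raw_eq]
    simp only [hz', Nat.pair_unpair]

theorem raw_range_comp : ComputablePred (· ∈ Set.range raw) := by
  apply PrimrecPred.computablePred
  rw [raw_range]
  have h1 : Primrec fun k : ℕ => (Nat.unpair k).1 := Primrec.fst.comp Primrec.unpair
  have h2 : Primrec fun k : ℕ => (Nat.unpair k).2 := Primrec.snd.comp Primrec.unpair
  have hd : Primrec fun k : ℕ => ((Nat.unpair k).1 + 1) / 2 :=
    Primrec.nat_div.comp (Primrec.succ.comp h1) (Primrec.const 2)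
  refine PrimrecPred.and (Primrec.nat_lt.comp (Primrec.const 0) h2) (PrimrecPred.and (Primrec.eq.comp hd hd) ?_)
  have R : PrimrecRel fun (x k : ℕ) => (x = 1 ∨ ¬ ((((Nat.unpair k).1 + 1) / 2) % x = 0 ∧ (Nat.unpair k).2 % x = 0)) := by
    refine PrimrecPred.or (Primrec.eq.comp Primrec.fst (Primrec.const 1)) (PrimrecPred.not (PrimrecPred.and ?_ ?_))
    · exact Primrec.eq.comp (Primrec.nat_mod.comp (hd.comp Primrec.snd) Primrec.fst) (Primrec.const 0)
    · exact Primrec.eq.comp (Primrec.nat_mod.comp (h2.comp Primrec.snd) Primrec.fst) (Primrec.const 0)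
  exact (PrimrecRel.forall_lt R).comp (Primrec.succ.comp h2) Primrec.id

theorem raw_comp : Computable raw := by
  let := @Encodable.decidableRangeEncode ℚ Rat.instEncodable
  let : Infinite (Set.range (@Encodable.encode ℚ Rat.instEncodable)) :=
    Infinite.of_injective _ (Equiv.ofInjective _ (@Encodable.encode_injective ℚ Rat.instEncodable)).injective
  have h := (ofNat_comp (Set.range (@Encodable.encode ℚ Rat.instEncodable)) raw_range_comp).comp
    (Computable.encode (α := ℚ))
  refine h.of_eq fun q => ?_
  let D := Nat.Subtype.denumerable (Set.range (@Encodable.encode ℚ Rat.instEncodable))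
  have e1 : ∀ n, Denumerable.ofNat (Set.range (@Encodable.encode ℚ Rat.instEncodable)) n = Nat.Subtype.ofNat _ n := by
    intro n
    rw [@Denumerable.ofEquiv_ofNat]
    rfl
  have e2 : (@Encodable.encode ℚ Rat.instDenumerable.toEncodable q : ℕ) = @Encodable.encode _ D.toEncodable (@Encodable.equivRangeEncode ℚ Rat.instEncodable q) := rfl
  show ((Nat.Subtype.ofNat _ (@Encodable.encode ℚ Rat.instDenumerable.toEncodable q) : _) : ℕ) = _
  rw [e2, ← e1, Denumerable.ofNat_encode]
  rfl

def pos (q : ℚ) : ℕ := q.num.toNat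
def neg (q : ℚ) : ℕ := (-q.num).toNat

theorem den_comp : Computable fun q : ℚ => q.den :=
  ((Computable.snd.comp Computable.unpair).comp raw_comp).of_eq fun q => by simp [raw_eq]

theorem num_comp : Computable fun q : ℚ => Encodable.encode q.num :=
  ((Computable.fst.comp Computable.unpair).comp raw_comp).of_eq fun q => by simp [raw_eq]

theorem pos_comp : Computable pos := by
  have : Computable fun q : ℚ => if Encodable.encode q.num % 2 = 0 then Encodable.encode q.num / 2 else 0 := by
    refine c_ite (cp_eq (c_mod num_comp (Computable.const 2)) (Computable.const 0))
      (c_div num_comp (Computable.const 2)) (Computable.const 0)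
  refine this.of_eq fun q => ?_
  rw [enc_int, pos]; split_ifs <;> omega

theorem neg_comp : Computable neg := by
  have : Computable fun q : ℚ => if Encodable.encode q.num % 2 = 0 then 0 else (Encodable.encode q.num + 1) / 2 := by
    refine c_ite (cp_eq (c_mod num_comp (Computable.const 2)) (Computable.const 0))
       (Computable.const 0) (c_div (Computable.succ.comp num_comp) (Computable.const 2))
  refine this.of_eq fun q => ?_
  rw [enc_int, neg]; split_ifs <;> omega

theorem q_eq (q : ℚ) : q = ((pos q : ℚ) - neg q) / q.den := by
  have : (q.num : ℚ) = (pos q : ℚ) - neg q := by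
    have h : q.num = (pos q : ℤ) - neg q := by unfold pos neg; omega
    rw [h]; push_cast; rfl
  rw [← this, Rat.num_div_den]

theorem den_posq (q : ℚ) : (0 : ℚ) < q.den := by exact_mod_cast q.pos

theorem mk_comp {α : Type*} [Primcodable α] {a b d : α → ℕ} (ha : Computable a) (hb : Computable b)
    (hd : Computable d) (hd0 : ∀ x, 0 < d x) :
    Computable fun x => ((a x : ℚ) - b x) / d x := by
  classical
  have hex : ∀ x, ∃ n : ℕ, pos (Denumerable.ofNat ℚ n) * d x + b x * (Denumerable.ofNat ℚ n).den =
      neg (Denumerable.ofNat ℚ n) * d x + a x * (Denumerable.ofNat ℚ n).den ∧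
        0 < d x := by
    intro x
    refine ⟨@Encodable.encode ℚ Rat.instDenumerable.toEncodable (((a x : ℚ) - b x) / d x), ?_, hd0 x⟩
    rw [Denumerable.ofNat_encode]
    have h1 := q_eq (((a x : ℚ) - b x) / d x)
    set q := ((a x : ℚ) - b x) / d x
    have h2 := den_posq q
    have h3 : (0 : ℚ) < d x := by exact_mod_cast hd0 x
    have h4 : q * d x = (a x : ℚ) - b x := by simp only [q]; field_simp
    have h5 : q * q.den = (pos q : ℚ) - neg q := by 
      conv_lhs => rw [h1]
      field_simp
      rw [← h1]
    have : ((pos q : ℚ) * d x + b x * q.den) = neg q * d x + a x * q.den := by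
      linear_combination (d x : ℚ) * (-h5) + q.den * h4
    exact_mod_cast this
  have hf : Computable (fun x => Nat.find (hex x)) := by
    apply Computable.find
    have h1 : Computable fun p : α × ℕ => Denumerable.ofNat ℚ p.2 := (Computable.ofNat ℚ).comp Computable.snd
    refine cp_and (cp_eq (c_add (c_mul (pos_comp.comp h1) (hd.comp Computable.fst))
      (c_mul (hb.comp Computable.fst) (den_comp.comp h1))) 
      (c_add (c_mul (neg_comp.comp h1) (hd.comp Computable.fst))
      (c_mul (ha.comp Computable.fst) (den_comp.comp h1)))) (cp_lt (Computable.const 0) (hd.comp Computable.fst))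
  refine ((Computable.ofNat ℚ).comp hf).of_eq fun x => ?_
  have := Nat.find_spec (hex x)
  set q := Denumerable.ofNat ℚ (Nat.find (hex x))
  rw [q_eq q]
  have h2 := den_posq q
  have h3 : (0 : ℚ) < d x := by exact_mod_cast hd0 x
  rw [div_eq_div_iff h2.ne' h3.ne']
  have h4 : ((pos q : ℚ) * d x + b x * q.den) = neg q * d x + a x * q.den := by exact_mod_cast this.1
  linarith

section
variable {α : Type*} [Primcodable α]

theorem q_nat {f : α → ℕ} (hf : Computable f) : Computable fun a => (f a : ℚ) :=
  (mk_comp hf (Computable.const 0) (Computable.const 1) (by simp)).of_eq fun a => by simp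

theorem q_add {f g : α → ℚ} (hf : Computable f) (hg : Computable g) : Computable fun a => f a + g a := by
  refine (mk_comp (a := fun x => pos (f x) * (g x).den + pos (g x) * (f x).den)
    (b := fun x => neg (f x) * (g x).den + neg (g x) * (f x).den)
    (d := fun x => (f x).den * (g x).den) ?_ ?_ ?_ ?_).of_eq ?_
  · exact c_add (c_mul (pos_comp.comp hf) (den_comp.comp hg)) (c_mul (pos_comp.comp hg) (den_comp.comp hf))
  · exact c_add (c_mul (neg_comp.comp hf) (den_comp.comp hg)) (c_mul (neg_comp.comp hg) (den_comp.comp hf))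
  · exact (c_mul (den_comp.comp hf) (den_comp.comp hg))
  · intro x; exact Nat.mul_pos (f x).pos (g x).pos
  · intro x
    conv_rhs => rw [q_eq (f x), q_eq (g x)]
    have h2 := (den_posq (f x)).ne'
    have h3 := (den_posq (g x)).ne'
    push_cast
    field_simp
    ring

theorem q_neg {f : α → ℚ} (hf : Computable f) : Computable fun a => - f a := by
  refine (mk_comp (a := fun x => neg (f x)) (b := fun x => pos (f x))
    (d := fun x => (f x).den) (neg_comp.comp hf) (pos_comp.comp hf) (den_comp.comp hf) fun x => (f x).pos).of_eq ?_
  intro x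
  conv_rhs => rw [q_eq (f x)]
  ring

theorem q_sub {f g : α → ℚ} (hf : Computable f) (hg : Computable g) : Computable fun a => f a - g a :=
  (q_add hf (q_neg hg)).of_eq fun a => by ring

theorem q_mul {f g : α → ℚ} (hf : Computable f) (hg : Computable g) : Computable fun a => f a * g a := by
  refine (mk_comp (a := fun x => pos (f x) * pos (g x) + neg (f x) * neg (g x))
    (b := fun x => pos (f x) * neg (g x) + neg (f x) * pos (g x))
    (d := fun x => (f x).den * (g x).den) ?_ ?_ ?_ ?_).of_eq ?_
  · exact c_add (c_mul (pos_comp.comp hf) (pos_comp.comp hg)) (c_mul (neg_comp.comp hf) (neg_comp.comp hg))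
  · exact c_add (c_mul (pos_comp.comp hf) (neg_comp.comp hg)) (c_mul (neg_comp.comp hf) (pos_comp.comp hg))
  · exact (c_mul (den_comp.comp hf) (den_comp.comp hg))
  · intro x; exact Nat.mul_pos (f x).pos (g x).pos
  · intro x
    conv_rhs => rw [q_eq (f x), q_eq (g x)]
    have h2 := (den_posq (f x)).ne'
    have h3 := (den_posq (g x)).ne'
    push_cast
    field_simp
    ring

theorem q_le {f g : α → ℚ} (hf : Computable f) (hg : Computable g) :
    ComputablePred fun a => f a ≤ g a := by
  have hs := q_sub hg hf
  refine (cp_eq (neg_comp.comp hs) (Computable.const 0)).of_eq fun a => ?_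
  have : 0 ≤ g a - f a ↔ f a ≤ g a := sub_nonneg
  rw [← this, ← Rat.num_nonneg, neg]
  omega

theorem q_lt {f g : α → ℚ} (hf : Computable f) (hg : Computable g) :
    ComputablePred fun a => f a < g a :=
  (q_le hg hf).not.of_eq fun a => by simp

theorem q_min {f g : α → ℚ} (hf : Computable f) (hg : Computable g) : Computable fun a => min (f a) (g a) :=
  (c_ite (q_le hf hg) hf hg).of_eq fun a => by rw [min_def]

theorem q_max {f g : α → ℚ} (hf : Computable f) (hg : Computable g) : Computable fun a => max (f a) (g a) :=
  (c_ite (q_le hf hg) hg hf).of_eq fun a => by rw [max_def]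

theorem q_pow (c : ℚ) {f : α → ℕ} (hf : Computable f) : Computable fun a => c ^ f a := by
  have : Computable fun n : ℕ => c ^ n := by
    refine (Computable.nat_rec (f := fun n : ℕ => n) (g := fun _ => (1 : ℚ))
       (h := fun _ p => p.2 * c) Computable.id (Computable.const _) ?_).of_eq ?_
    · exact q_mul (Computable.snd.comp Computable.snd) (Computable.const _)
    · intro n
      induction n with
      | zero => simp
      | succ n ih => simp only [ih, pow_succ]
  exact this.comp hf

theorem c_npow (c : ℕ) {f : α → ℕ} (hf : Computable f) : Computable fun a => c ^ f a := by
  have : Computable fun n : ℕ => c ^ n := by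
    refine (Computable.nat_rec (f := fun n : ℕ => n) (g := fun _ => (1 : ℕ))
       (h := fun _ p => p.2 * c) Computable.id (Computable.const _) ?_).of_eq ?_
    · exact c_mul (Computable.snd.comp Computable.snd) (Computable.const _)
    · intro n
      induction n with
      | zero => simp
      | succ n ih => simp only [ih, pow_succ]
  exact this.comp hf

theorem q_sum {f : α → ℕ} (hf : Computable f) {g : α → ℕ → ℚ} (hg : Computable₂ g) :
    Computable fun a => ∑ n ∈ Finset.range (f a), g a n := by
  refine (Computable.nat_rec (f := f) (g := fun _ => (0 : ℚ))
       (h := fun a p => p.2 + g a p.1) hf (Computable.const _) ?_).of_eq ?_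
  · exact q_add (Computable.snd.comp Computable.snd) 
      (hg.comp Computable.fst (Computable.fst.comp Computable.snd))
  · intro a
    generalize f a = n
    induction n with
      | zero => simp
      | succ n ih => simp only [ih, Finset.sum_range_succ]

theorem cp_exists {p : α → ℕ → Prop} {f : α → ℕ} (hf : Computable f)
    (hp : ComputablePred fun x : α × ℕ => p x.1 x.2) : ComputablePred fun a => ∃ n < f a, p a n := by
  obtain ⟨g, hg, hg'⟩ := ComputablePred.computable_iff.1 hp
  have hg2 : ∀ a n, p a n ↔ g (a, n) = true := fun a n => by
    have := congrFun hg' (a, n); simpa using this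
  have : Computable fun a => (Nat.rec false (fun n b => b || g (a, n)) (f a) : Bool) :=
    Computable.nat_rec (h := fun a (p : ℕ × Bool) => p.2 || g (a, p.1)) hf (Computable.const _) 
     (Primrec.or.to_comp.comp (Computable.snd.comp Computable.snd) 
       (hg.comp (Computable.fst.pair (Computable.fst.comp Computable.snd))))
  refine ComputablePred.computable_iff.2 ⟨_, this, ?_⟩
  funext a
  apply propext
  generalize f a = N
  induction N with
  | zero => simp
  | succ n ih =>
    simp only [Bool.or_eq_true, ← ih, Nat.lt_succ_iff_lt_or_eq, hg2]
    constructor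
    · rintro ⟨k, h | rfl, h'⟩
      · exact Or.inl ⟨k, h, h'⟩
      · exact Or.inr h'
    · rintro (⟨k, h, h'⟩ | h)
      · exact ⟨k, Or.inl h, h'⟩
      · exact ⟨n, Or.inr rfl, h⟩

end

end OmegaPf


namespace OmegaPf

theorem stage {α β : Type*} [Primcodable α] [Primcodable β] {f : α →. β} (hf : Partrec f) :
    ∃ F : ℕ → α → Option β, Computable₂ F ∧ (∀ k l a y, k ≤ l → F k a = some y → F l a = some y) ∧
      ∀ a y, y ∈ f a ↔ ∃ k, F k a = some y := by
  obtain ⟨c, hc⟩ := Nat.Partrec.Code.exists_code.1 hf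
  have key : ∀ k a (z : ℕ), z ∈ Nat.Partrec.Code.evaln k c (Encodable.encode a) →
      ∃ y ∈ f a, z = Encodable.encode y := by
    intro k a z hz
    have := Nat.Partrec.Code.evaln_sound hz
    rw [hc] at this
    simp at this
    obtain ⟨y, hy, rfl⟩ := this
    exact ⟨y, hy, rfl⟩
  refine ⟨fun k a => (Nat.Partrec.Code.evaln k c (Encodable.encode a)).bind Encodable.decode, ?_, ?_, ?_⟩
  · have h1 : Computable fun p : ℕ × α => Nat.Partrec.Code.evaln p.1 c (Encodable.encode p.2) :=
      Nat.Partrec.Code.primrec_evaln.to_comp.comp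
        ((Computable.fst.pair (Computable.const c)).pair (Computable.encode.comp Computable.snd))
    exact Computable.option_bind h1 (Computable.decode.comp Computable.snd)
  · intro k l a y hkl h
    simp only [Option.bind_eq_some_iff] at h ⊢
    obtain ⟨z, hz, hy⟩ := h
    exact ⟨z, Nat.Partrec.Code.evaln_mono hkl hz, hy⟩
  · intro a y
    constructor
    · intro hy
      have : Encodable.encode y ∈ Nat.Partrec.Code.eval c (Encodable.encode a) := by
        rw [hc]; simp [hy]
      obtain ⟨k, hk⟩ := Nat.Partrec.Code.evaln_complete.1 this
      refine ⟨k, ?_⟩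
      simp only [Option.bind_eq_some_iff]
      exact ⟨_, hk, Encodable.encodek y⟩
    · rintro ⟨k, hk⟩
      simp only [Option.bind_eq_some_iff] at hk
      obtain ⟨z, hz, hy⟩ := hk
      obtain ⟨y', hy', rfl⟩ := key k a z hz
      rw [Encodable.encodek] at hy
      cases hy; exact hy'

/-- weight -/
def wt (σ : List Bool) : ℚ := (1 / 2) ^ σ.length

/-- weight of a finite set -/
def W (A : Finset (List Bool)) : ℚ := ∑ σ ∈ A, wt σ

theorem wt_pos (σ : List Bool) : 0 < wt σ := by unfold wt; positivity

theorem W_mono {A B : Finset (List Bool)} (h : A ⊆ B) : W A ≤ W B :=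
  Finset.sum_le_sum_of_subset_of_nonneg h fun σ _ _ => (wt_pos σ).le

theorem W_nonneg (A : Finset (List Bool)) : 0 ≤ W A := Finset.sum_nonneg fun σ _ => (wt_pos σ).le

theorem wt_append (σ τ : List Bool) : wt (σ ++ τ) = wt σ * wt τ := by
  unfold wt; rw [List.length_append, pow_add]

open Classical in
/-- finite set of strings of code below `s` satisfying `p` -/
noncomputable def fset (s : ℕ) (p : List Bool → Prop) : Finset (List Bool) :=
  ((Finset.range s).biUnion fun n => (Encodable.decode (α := List Bool) n).toFinset).filter
    fun σ => Encodable.encode σ < s ∧ p σ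

theorem mem_fset {s : ℕ} {p : List Bool → Prop} {σ : List Bool} :
    σ ∈ fset s p ↔ Encodable.encode σ < s ∧ p σ := by
  classical
  unfold fset
  simp only [Finset.mem_filter, Finset.mem_biUnion, Finset.mem_range, Option.mem_toFinset,
    Option.mem_def, and_iff_right_iff_imp]
  rintro ⟨h, -⟩
  exact ⟨_, h, Encodable.encodek σ⟩

theorem card_fset (s : ℕ) (p : List Bool → Prop) : (fset s p).card ≤ s := by
  classical
  calc (fset s p).card = ((fset s p).image Encodable.encode).card :=
        (Finset.card_image_of_injective _ Encodable.encode_injective).symm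
    _ ≤ (Finset.range s).card := by
        apply Finset.card_le_card
        intro n hn
        simp only [Finset.mem_image, mem_fset] at hn
        obtain ⟨σ, h, rfl⟩ := hn
        exact Finset.mem_range.2 h.1
    _ = s := Finset.card_range s

theorem length_lt_of_mem {s : ℕ} {p : List Bool → Prop} {σ : List Bool} (h : σ ∈ fset s p) :
    σ.length < s := lt_of_le_of_lt (Encodable.length_le_encode σ) (mem_fset.1 h).1

theorem W_fset_comp {p : ℕ → List Bool → Prop}
    (hp : ComputablePred fun x : ℕ × List Bool => p x.1 x.2) : Computable fun s => W (fset s (p s)) := by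
  classical
  have h1 : Computable₂ fun (s n : ℕ) => (Option.casesOn (motive := fun _ => ℚ) (Encodable.decode (α := List Bool) n) (0 : ℚ)
      fun σ => if Encodable.encode σ = n ∧ p s σ then wt σ else 0 : ℚ) := by
    refine Computable.option_casesOn (f := fun _ => (0:ℚ)) 
      (g := fun (x : ℕ × ℕ) σ => if Encodable.encode σ = x.2 ∧ p x.1 σ then wt σ else 0)
      (Computable.decode.comp Computable.snd) (Computable.const _) ?_
    refine c_ite (cp_and (cp_eq (Computable.encode.comp Computable.snd) 
      (Computable.snd.comp Computable.fst)) (cp_comp hp ((Computable.fst.comp Computable.fst).pair 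
      Computable.snd))) (q_pow _ (Computable.list_length.comp Computable.snd)) (Computable.const _)
  refine (q_sum Computable.id h1).of_eq fun s => ?_
  unfold W
  symm
  refine Finset.sum_of_injOn Encodable.encode Encodable.encode_injective.injOn ?_ ?_ ?_
  · intro σ hσ
    simpa using (mem_fset.1 hσ).1
  · intro n hn hn'
    rcases h : (Encodable.decode (α := List Bool) n) with _ | σ
    · rfl
    · simp only
      rw [if_neg]
      rintro ⟨h1, h2⟩
      exact hn' ⟨σ, mem_fset.2 ⟨by rw [h1]; simpa using hn, h2⟩, h1⟩
  · intro σ hσ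
    rw [Encodable.encodek]
    simp [(mem_fset.1 hσ).2]

theorem kraft_aux (N : ℕ) : ∀ A : Finset (List Bool), (∀ σ ∈ A, σ.length ≤ N) →
    (∀ σ ∈ A, ∀ τ ∈ A, σ <+: τ → σ = τ) → W A ≤ 1 := by
  classical
  induction N with
  | zero =>
    intro A hA _
    have : A ⊆ {[]} := by
      intro σ hσ
      have := hA σ hσ
      simpa using this
    refine (W_mono this).trans ?_
    simp [W, wt]
  | succ N ih =>
    intro A hA hp
    by_cases hnil : [] ∈ A
    · have : A ⊆ {[]} := by
        intro σ hσ
        have := hp [] hnil σ hσ (List.nil_prefix)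
        simp [← this]
      refine (W_mono this).trans ?_
      simp [W, wt]
    · let A' : Bool → Finset (List Bool) := fun b => A.preimage (List.cons b) (by intro x _ y _ h; simpa using h)
      have mA : ∀ b σ, σ ∈ A' b ↔ b :: σ ∈ A := fun b σ => Finset.mem_preimage
      have hsub : A ⊆ (A' true).image (List.cons true) ∪ (A' false).image (List.cons false) := by
        intro σ hσ
        rcases σ with _ | ⟨b, σ⟩
        · exact absurd hσ hnil
        · cases b <;> simp [mA, hσ]
      have hW : ∀ b, W (A' b) ≤ 1 := by
        intro b
        apply ih
        · intro σ hσ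
          have := hA (b :: σ) ((mA _ _).1 hσ)
          simpa using this
        · intro σ hσ τ hτ h
          have := hp (b :: σ) ((mA _ _).1 hσ) (b :: τ) ((mA _ _).1 hτ) (by simpa using h)
          simpa using this
      have hI : ∀ b, W ((A' b).image (List.cons b)) = W (A' b) / 2 := by
        intro b
        unfold W
        rw [Finset.sum_image (by intro x _ y _ h; simpa using h), Finset.sum_div]
        refine Finset.sum_congr rfl fun σ _ => ?_
        simp [wt, pow_succ]; ring
      have h1 := W_mono hsub
      have h2 : W ((A' true).image (List.cons true) ∪ (A' false).image (List.cons false)) ≤ 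
        W ((A' true).image (List.cons true)) + W ((A' false).image (List.cons false)) := by
        unfold W
        rw [← Finset.sum_union_inter]
        have := W_nonneg ((A' true).image (List.cons true) ∩ (A' false).image (List.cons false))
        unfold W at this
        linarith
      rw [hI, hI] at h2
      have := hW true
      have := hW false
      linarith

theorem kraft {M : List Bool →. List Bool} (hM : PrefixFreeDomain M) (A : Finset (List Bool))
    (hA : ∀ σ ∈ A, (M σ).Dom) : W A ≤ 1 :=
  kraft_aux (A.sup List.length) A (fun _ h => Finset.le_sup (f := List.length) h)
    fun σ hσ τ hτ h => hM σ τ h (hA σ hσ) (hA τ hτ)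

theorem univ1 {U : List Bool →. List Bool} (hU : UniversalPFM U) {M : List Bool →. List Bool}
    (hM : Partrec M) (hp : PrefixFreeDomain M) : ∃ ρ, ∀ τ, U (ρ ++ τ) = M τ := by
  obtain ⟨g, -, hg⟩ := hU.2 (fun _ => M) (hM.comp Computable.snd) (fun _ => hp)
  exact ⟨g 0, hg 0⟩

/-- binary value, most significant bit first -/
def val (τ : List Bool) : ℕ := τ.foldl (fun n b => 2 * n + cond b 1 0) 0

theorem val_snoc (τ : List Bool) (b : Bool) : val (τ ++ [b]) = 2 * val τ + cond b 1 0 := by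
  simp [val]

theorem val_comp : Computable val := by
  apply Primrec.to_comp
  refine Primrec.list_foldl (f := fun τ : List Bool => τ) (g := fun _ => 0)
    (h := fun _ (p : ℕ × Bool) => 2 * p.1 + cond p.2 1 0) Primrec.id (Primrec.const 0) ?_
  exact Primrec.nat_add.comp (Primrec.nat_mul.comp (Primrec.const 2) (Primrec.fst.comp Primrec.snd))
    (Primrec.cond (Primrec.snd.comp Primrec.snd) (Primrec.const 1) (Primrec.const 0))

/-- string of given length and value -/
def str : ℕ → ℕ → List Bool
  | 0, _ => []
  | l + 1, n => str l (n / 2) ++ [decide (n % 2 = 1)]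

theorem str_length (l n : ℕ) : (str l n).length = l := by
  induction l generalizing n with
  | zero => rfl
  | succ l ih => simp [str, ih]

theorem val_str (l n : ℕ) (h : n < 2 ^ l) : val (str l n) = n := by
  induction l generalizing n with
  | zero => simp at h; subst h; rfl
  | succ l ih =>
    rw [str, val_snoc, ih _ (by rw [pow_succ] at h; omega)]
    by_cases h : n % 2 = 1 <;> simp [h] <;> omega

/-- basic data extracted from a universal machine -/
structure Dat (U : List Bool →. List Bool) where
  F : ℕ → List Bool → Option (List Bool)
  comp : Computable₂ F
  mono : ∀ k l a y, k ≤ l → F k a = some y → F l a = some y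
  spec : ∀ a y, y ∈ U a ↔ ∃ k, F k a = some y

theorem exists_dat {U : List Bool →. List Bool} (hU : UniversalPFM U) : Nonempty (Dat U) := by
  obtain ⟨F, h1, h2, h3⟩ := stage hU.1.1
  exact ⟨⟨F, h1, h2, h3⟩⟩

namespace Dat
variable {U : List Bool →. List Bool} (D : Dat U)

noncomputable def P (s : ℕ) : Finset (List Bool) := fset s fun σ => (D.F s σ).isSome

noncomputable def O (s : ℕ) : ℚ := W (D.P s)

theorem P_mono : Monotone D.P := by
  intro s t h σ hσ
  unfold P at *
  rw [mem_fset] at *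
  refine ⟨hσ.1.trans_le h, ?_⟩
  obtain ⟨y, hy⟩ := Option.isSome_iff_exists.1 hσ.2
  rw [D.mono _ _ _ _ h hy]; rfl

theorem dom_of_mem {s : ℕ} {σ : List Bool} (h : σ ∈ D.P s) : (U σ).Dom := by
  obtain ⟨y, hy⟩ := Option.isSome_iff_exists.1 (mem_fset.1 h).2
  exact Part.dom_iff_mem.2 ⟨y, (D.spec _ _).2 ⟨_, hy⟩⟩

theorem mem_of_dom {σ : List Bool} (h : (U σ).Dom) : ∃ s, σ ∈ D.P s := by
  obtain ⟨y, hy⟩ := Part.dom_iff_mem.1 h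
  obtain ⟨k, hk⟩ := (D.spec _ _).1 hy
  refine ⟨max k (Encodable.encode σ + 1), mem_fset.2 ⟨by omega, ?_⟩⟩
  rw [D.mono k _ _ _ (le_max_left _ _) hk]; rfl

theorem O_comp : Computable D.O := by
  apply W_fset_comp (p := fun s σ => (D.F s σ).isSome)
  exact ComputablePred.computable_iff.2 ⟨_, Primrec.option_isSome.to_comp.comp D.comp, by ext; rfl⟩

theorem O_mono : Monotone D.O := fun _ _ h => W_mono (D.P_mono h)

theorem O_nonneg (s : ℕ) : 0 ≤ D.O s := W_nonneg _

theorem O_le_one (hU : UniversalPFM U) (s : ℕ) : D.O s ≤ 1 :=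
  kraft hU.1.2 _ fun _ h => D.dom_of_mem h

noncomputable def Om : ℝ := ⨆ s, (D.O s : ℝ)

theorem O_tendsto (hU : UniversalPFM U) : Tendsto (fun s => (D.O s : ℝ)) atTop (nhds D.Om) := by
  apply tendsto_atTop_ciSup
  · intro s t h; exact Rat.cast_le.2 (D.O_mono h)
  · refine ⟨1, ?_⟩
    rintro _ ⟨s, rfl⟩
    have := (Rat.cast_le (K := ℝ)).2 (D.O_le_one hU s)
    simpa using this

theorem W_le_Om (hU : UniversalPFM U) (A : Finset (List Bool)) (h : ∀ σ ∈ A, (U σ).Dom) :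
    (W A : ℝ) ≤ D.Om := by
  have h1 : ∃ s, A ⊆ D.P s := by
    classical
    induction A using Finset.induction_on with
    | empty => exact ⟨0, by simp⟩
    | insert a A ha ih =>
      obtain ⟨s, hs⟩ := ih fun σ hσ => h σ (Finset.mem_insert_of_mem hσ)
      obtain ⟨t, ht⟩ := D.mem_of_dom (h a (Finset.mem_insert_self _ _))
      refine ⟨max s t, ?_⟩
      intro x hx
      rcases Finset.mem_insert.1 hx with rfl | hx
      · exact D.P_mono (le_max_right _ _) ht
      · exact D.P_mono (le_max_left _ _) (hs hx)
  obtain ⟨s, hs⟩ := h1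
  have h2 : (W A : ℝ) ≤ D.O s := by exact_mod_cast W_mono hs
  exact h2.trans (Monotone.ge_of_tendsto (fun s t h => by exact_mod_cast D.O_mono h) (D.O_tendsto hU) s)

end Dat

theorem toolT {U : List Bool →. List Bool} (hU : UniversalPFM U) (D : Dat U) (m : ℕ → ℚ)
    (hm : Computable m) (mono : Monotone m) (m0 : ∀ s, 0 ≤ m s) (m1 : ∀ s, m s ≤ 1) :
    ∃ C : ℝ, 0 < C ∧ ∀ s t, (m t - m s : ℝ) ≤ C * (D.Om - D.O s) := by
  classical
  let n : ℕ → ℕ := fun t => pos (2 ^ t * m t) / (2 ^ t * m t : ℚ).den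
  have hn : Computable n :=
    have : Computable fun t => ((2 : ℚ) ^ t * m t) := q_mul (q_pow 2 Computable.id) hm
    c_div (pos_comp.comp this) (den_comp.comp this)
  have hq : ∀ q : ℚ, 0 ≤ q → ((pos q / q.den : ℕ) : ℚ) ≤ q ∧ q < ((pos q / q.den : ℕ) : ℚ) + 1 := by
    intro q hq
    have h0 : neg q = 0 := by unfold neg; have := Rat.num_nonneg.2 hq; omega
    have h1 := q_eq q
    rw [h0] at h1
    have h2 := den_posq q
    have h3 : q * q.den = pos q := by
      conv_lhs => rw [h1]
      field_simp
      rw [← h1]; simp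
    constructor
    · rw [← mul_le_mul_iff_left₀ h2, h3]
      exact_mod_cast Nat.div_mul_le_self _ _
    · rw [← mul_lt_mul_iff_left₀ h2, h3]
      have := Nat.lt_div_mul_add (a := pos q) q.pos
      have h4 : (pos q : ℚ) < ((pos q / q.den * q.den + q.den : ℕ) : ℚ) := by exact_mod_cast this
      push_cast at h4 ⊢
      linarith
  have n1 : ∀ t, (n t : ℚ) ≤ 2 ^ t * m t := fun t => (hq _ (mul_nonneg (by positivity) (m0 t))).1
  have n2 : ∀ t, 2 ^ t * m t < (n t : ℚ) + 1 := fun t => (hq _ (mul_nonneg (by positivity) (m0 t))).2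
  have n3 : ∀ t, 2 * n t ≤ n (t + 1) := by
    intro t
    have h1 := n1 t
    have h2 := n2 (t + 1)
    have h3 := mono (Nat.le_succ t)
    have h4 : (2 : ℚ) ^ (t + 1) * m t ≤ 2 ^ (t + 1) * m (t + 1) := by gcongr
    rw [pow_succ] at h4 h2
    have : ((2 * n t : ℕ) : ℚ) < ((n (t + 1) + 1 : ℕ) : ℚ) := by push_cast; nlinarith
    have := Nat.cast_lt.1 this
    omega
  have n4 : ∀ t, n t ≤ 2 ^ t := by
    intro t
    have : (n t : ℚ) ≤ (2 ^ t : ℕ) := by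
      push_cast
      have h : (2 : ℚ) ^ t * m t ≤ 2 ^ t * 1 := by gcongr; exact m1 t
      linarith [n1 t]
    exact_mod_cast this
  let dm : List Bool → Prop := fun τ => val τ < n τ.length ∧ (τ.length = 0 ∨ 2 * n (τ.length - 1) ≤ val τ)
  let M : List Bool →. List Bool := fun τ => (Part.assert (dm τ) fun _ => Part.some ()).map fun _ => []
  have hMdom : ∀ τ, (M τ).Dom ↔ dm τ := by intro τ; simp [M, Part.assert]
  have hM : Partrec M := by
    have h1 : ComputablePred dm := by
      refine cp_and (cp_lt val_comp (hn.comp Computable.list_length)) (cp_or (cp_eq Computable.list_length (Computable.const 0)) (cp_le (c_mul (Computable.const 2) (hn.comp (c_sub Computable.list_length (Computable.const 1)))) val_comp))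
    exact Partrec.map h1.to_re (Computable.const []).to₂
  have ext : ∀ σ ρ : List Bool, val σ < n σ.length → val (σ ++ ρ) < n (σ ++ ρ).length := by
    intro σ ρ h
    induction ρ using List.reverseRecOn with
    | nil => simpa using h
    | append_singleton ρ b ih =>
      rw [← List.append_assoc, val_snoc, List.length_append]
      have := n3 (σ ++ ρ).length
      have hb : cond b 1 0 ≤ 1 := by cases b <;> simp
      simp only [List.length_singleton]
      omega
  have hpf : PrefixFreeDomain M := by
    intro σ τ hστ hσ hτ
    rw [hMdom] at hσ hτ
    obtain ⟨ρ, rfl⟩ := hστ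
    rcases List.eq_nil_or_concat ρ with rfl | ⟨ρ', b, rfl⟩
    · simp
    · exfalso
      rw [List.concat_eq_append, ← List.append_assoc] at hτ
      have h1 := ext σ ρ' hσ.1
      rcases hτ.2 with h | h
      · simp at h
      · rw [val_snoc] at h
        have hb : cond b 1 0 ≤ 1 := by cases b <;> simp
        rw [List.length_append (as := σ ++ ρ')] at h
        simp only [List.length_singleton, Nat.add_sub_cancel] at h
        omega
  obtain ⟨ρ, hρ⟩ := univ1 hU hM hpf
  have hA : ∀ s d, ∃ A : Finset (List Bool), (∀ τ ∈ A, dm τ ∧ s < τ.length ∧ τ.length ≤ s + d) ∧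
      W A = n (s + d) / 2 ^ (s + d) - n s / 2 ^ s := by
    intro s d
    induction d with
    | zero => exact ⟨∅, by simp, by simp [W]⟩
    | succ d ih =>
      obtain ⟨A, hA1, hA2⟩ := ih
      have hinj : Set.InjOn (str (s + d + 1)) (Finset.Ico (2 * n (s + d)) (n (s + d + 1)) : Set ℕ) := by
        intro x hx y hy h
        have hx := (Finset.mem_Ico.1 (Finset.mem_coe.1 hx)).2
        have hy := (Finset.mem_Ico.1 (Finset.mem_coe.1 hy)).2
        have := congrArg val h
        rwa [val_str _ _ (hx.trans_le (n4 _)), val_str _ _ (hy.trans_le (n4 _))] at this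
      refine ⟨A ∪ (Finset.Ico (2 * n (s + d)) (n (s + d + 1))).image (str (s + d + 1)), ?_, ?_⟩
      · intro τ hτ
        rcases Finset.mem_union.1 hτ with h | h
        · obtain ⟨h1, h2, h3⟩ := hA1 τ h
          exact ⟨h1, h2, by omega⟩
        · obtain ⟨x, hx, rfl⟩ := Finset.mem_image.1 h
          have hx := Finset.mem_Ico.1 hx
          refine ⟨⟨?_, Or.inr ?_⟩, ?_, ?_⟩
          · rw [val_str _ _ (hx.2.trans_le (n4 _)), str_length]; exact hx.2
          · rw [val_str _ _ (hx.2.trans_le (n4 _)), str_length]; exact hx.1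
          · rw [str_length]; omega
          · rw [str_length]; omega
      · unfold W at *
        rw [Finset.sum_union, hA2, Finset.sum_image hinj]
        · have : ∀ x, wt (str (s + d + 1) x) = (1 / 2) ^ (s + d + 1) := by
            intro x; unfold wt; rw [str_length]
          simp only [this, Finset.sum_const, Nat.card_Ico, nsmul_eq_mul]
          rw [Nat.cast_sub (n3 _)]
          push_cast
          rw [show s + (d + 1) = s + d + 1 by ring, one_div, inv_pow, pow_succ (2 : ℚ) (s + d)]
          field_simp
          ring
        · rw [Finset.disjoint_left]
          intro τ h1 h2
          obtain ⟨x, hx, rfl⟩ := Finset.mem_image.1 h2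
          have := (hA1 _ h1).2.2
          rw [str_length] at this
          omega
  refine ⟨1 / wt ρ, by have := wt_pos ρ; positivity, ?_⟩
  have hwr : (0 : ℝ) < wt ρ := by exact_mod_cast wt_pos ρ
  have main : ∀ s d, (wt ρ : ℝ) * (m (s + d) - m s - (1 / 2) ^ (s + d)) ≤ D.Om - D.O s := by
    intro s d
    obtain ⟨A, hA1, hA2⟩ := hA s d
    have h1 := D.W_le_Om hU (D.P s ∪ A.image (ρ ++ ·)) (by
      intro σ hσ
      rcases Finset.mem_union.1 hσ with h | h
      · exact D.dom_of_mem h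
      · obtain ⟨τ, hτ, rfl⟩ := Finset.mem_image.1 h
        show (U (ρ ++ τ)).Dom
        rw [hρ, hMdom]; exact (hA1 τ hτ).1)
    have h2 : W (D.P s ∪ A.image (ρ ++ ·)) = D.O s + wt ρ * W A := by
      unfold Dat.O W
      rw [Finset.sum_union, Finset.sum_image (by intro x _ y _ h; simpa using h), Finset.mul_sum]
      · simp only [wt_append]
      · rw [Finset.disjoint_left]
        intro τ h1 h2
        obtain ⟨x, hx, rfl⟩ := Finset.mem_image.1 h2
        have := length_lt_of_mem h1
        have h3 := (hA1 x hx).2.1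
        simp at this
        omega
    rw [h2] at h1
    have h3 : m (s + d) - m s - (1 / 2) ^ (s + d) ≤ W A := by
      rw [hA2]
      have e1 := n2 (s + d)
      have e2 := n1 s
      have p1 : (0 : ℚ) < 2 ^ (s + d) := by positivity
      have p2 : (0 : ℚ) < 2 ^ s := by positivity
      have e3 : (n s : ℚ) / 2 ^ s ≤ m s := by rw [div_le_iff₀ p2]; linarith
      have e4 : m (s + d) ≤ (n (s + d) : ℚ) / 2 ^ (s + d) + (1 / 2) ^ (s + d) := by
        rw [one_div, inv_pow, ← one_div, ← add_div, le_div_iff₀ p1]; linarith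
      linarith
    have h4 : (m (s + d) - m s - (1 / 2) ^ (s + d) : ℝ) ≤ W A := by
      have := (Rat.cast_le (K := ℝ)).2 h3
      push_cast at this ⊢
      exact this
    push_cast at h1
    nlinarith
  intro s t
  have hlim : Tendsto (fun d : ℕ => (wt ρ : ℝ) * (m t - m s - (1 / 2) ^ (s + d))) atTop
      (nhds ((wt ρ : ℝ) * (m t - m s - 0))) := by
    refine Tendsto.const_mul _ (Tendsto.const_sub _ ?_)
    have := tendsto_pow_atTop_nhds_zero_of_lt_one (r := (1 / 2 : ℝ)) (by norm_num) (by norm_num)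
    exact this.comp (tendsto_add_atTop_iff_nat s |>.2 tendsto_id |>.congr fun d => by simp [add_comm])
  have : (wt ρ : ℝ) * (m t - m s - 0) ≤ D.Om - D.O s := by
    refine le_of_tendsto hlim ?_
    filter_upwards [eventually_ge_atTop t] with d hd
    refine le_trans ?_ (main s d)
    have : (m t : ℝ) ≤ m (s + d) := by exact_mod_cast mono (by omega)
    gcongr
  rw [div_mul_eq_mul_div, one_mul, le_div_iff₀ hwr]
  linarith

/-- The tool for families. -/
def TFam (O : ℕ → ℚ) (Om : ℝ) : Prop :=
  ∀ m : ℕ → ℕ → ℚ, Computable₂ m → (∀ j, Monotone (m j)) → (∀ j t, 0 ≤ m j t) →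
    (∀ j t, m j t ≤ 1) → ∃ C : ℝ, 0 < C ∧ ∀ j s t, (m j t - m j s : ℝ) ≤ C * 2 ^ j * (Om - O s)

theorem tfam {U : List Bool →. List Bool} (hU : UniversalPFM U) (D : Dat U) : TFam D.O D.Om := by
  intro m hm mono m0 m1
  let M : ℕ → ℚ := fun s => ∑ j ∈ Finset.range s, (1 / 2 : ℚ) ^ (j + 1) * m j s
  have hM : Computable M := q_sum Computable.id
    (q_mul (q_pow _ (Computable.succ.comp Computable.snd)) (hm.comp Computable.snd Computable.fst))
  have key : ∀ j s t, s ≤ t → j < t → (1 / 2 : ℚ) ^ (j + 1) * (m j t - m j s) ≤ M t - M s := by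
    intro j s t hst hj
    have h1 : M s ≤ ∑ i ∈ Finset.range t, (1 / 2 : ℚ) ^ (i + 1) * m i s :=
      Finset.sum_le_sum_of_subset_of_nonneg (by simpa using hst) 
        fun i _ _ => mul_nonneg (by positivity) (m0 i s)
    have h2 : (1 / 2 : ℚ) ^ (j + 1) * (m j t - m j s) ≤
        ∑ i ∈ Finset.range t, (1 / 2 : ℚ) ^ (i + 1) * (m i t - m i s) := by
      refine Finset.single_le_sum (f := fun i => (1 / 2 : ℚ) ^ (i + 1) * (m i t - m i s)) ?_ (Finset.mem_range.2 hj)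
      intro i _
      exact mul_nonneg (by positivity) (sub_nonneg.2 (mono i hst))
    simp only [mul_sub, Finset.sum_sub_distrib] at h2 ⊢
    linarith
  have Mmono : Monotone M := by
    intro s t hst
    rcases hst.eq_or_lt with rfl | h
    · rfl
    · have := key s s t hst h
      have h2 := mul_nonneg (show (0 : ℚ) ≤ (1 / 2) ^ (s + 1) by positivity) (sub_nonneg.2 (mono s hst))
      linarith
  obtain ⟨C, hC, hT⟩ := toolT hU D M hM Mmono
    (fun s => Finset.sum_nonneg fun j _ => mul_nonneg (by positivity) (m0 j s))
    (fun s => by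
      calc M s ≤ ∑ j ∈ Finset.range s, (1 / 2 : ℚ) ^ (j + 1) := by
            refine Finset.sum_le_sum fun j _ => ?_
            exact mul_le_of_le_one_right (by positivity) (m1 j s)
        _ = 1 - (1 / 2) ^ s := by
            induction s with
            | zero => simp
            | succ n ih => rw [Finset.sum_range_succ, ih]; ring
        _ ≤ 1 := by simp)
  refine ⟨2 * C, by positivity, ?_⟩
  intro j s t
  have h1 := key j s (max (max s t) (j + 1)) (by omega) (by omega)
  have h2 := hT s (max (max s t) (j + 1))
  set T := max (max s t) (j + 1)
  have h3 : m j t ≤ m j T := mono j (by omega)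
  have h1' : (1 / 2 : ℝ) ^ (j + 1) * (m j T - m j s) ≤ M T - M s := by
    have := (Rat.cast_le (K := ℝ)).2 h1
    push_cast at this ⊢
    exact this
  have h3' : (m j t : ℝ) ≤ m j T := by exact_mod_cast h3
  have h4 : (m j T - m j s : ℝ) ≤ 2 ^ (j + 1) * (C * (D.Om - D.O s)) := by
    have h5 := h1'.trans h2
    rw [one_div, inv_pow, inv_mul_le_iff₀ (by positivity)] at h5
    exact h5
  rw [pow_succ] at h4
  linarith

theorem tfam_shift {O : ℕ → ℚ} {Om : ℝ} (h : TFam O Om) (c : ℕ) : TFam (fun n => O (n + c)) Om := by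
  intro m hm mono m0 m1
  obtain ⟨C, hC, hT⟩ := h (fun j t => m j (t - c))
    (hm.comp Computable.fst (c_sub Computable.snd (Computable.const c)))
    (fun j s t hst => mono j (by omega)) (fun j t => m0 _ _) (fun j t => m1 _ _)
  refine ⟨C, hC, fun j s t => ?_⟩
  have := hT j (s + c) (t + c)
  simpa using this

theorem tfam_strict {O : ℕ → ℚ} {Om : ℝ} (h : TFam O Om) (s : ℕ) : (O s : ℝ) < Om := by
  have hc : Computable fun p : ℕ × ℕ => (1 : ℚ) - (1 / 2) ^ p.2 :=
    q_sub (Computable.const 1) (q_pow _ Computable.snd)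
  obtain ⟨C, hC, hT⟩ := h (fun _ t => (1 : ℚ) - (1 / 2) ^ t) hc
    (fun j s t hst => sub_le_sub_left (pow_le_pow_of_le_one (by norm_num) (by norm_num) hst) _)
    (fun j t => sub_nonneg.2 (pow_le_one₀ (by norm_num) (by norm_num))) (fun j t => by simp)
  have := hT 0 s (s + 1)
  push_cast at this
  rw [pow_succ] at this
  have h2 : (0 : ℝ) < (1 / 2) ^ s := by positivity
  have h3 : 0 < C * 2 ^ 0 * (Om - O s) := by linarith
  have := pos_of_mul_pos_right h3 (by positivity)
  linarith

end OmegaPf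


namespace OmegaPf

section dich
variable (O B : ℕ → ℚ) (d r : ℚ)

def ZZ (k n : ℕ) : ℚ := r ^ k * (if k % 2 = 0 then O n else d * B n)

def LL : ℕ → ℕ → ℚ
  | 0, n => O n
  | _ + 1, 0 => 0
  | k + 1, n + 1 => min (LL k (n + 1)) (LL (k + 1) n + ZZ O B d r (k + 1) (n + 1) - ZZ O B d r (k + 1) n)

variable {O B d r}

theorem ZZ_comp (hO : Computable O) (hB : Computable B) : Computable₂ (ZZ O B d r) := by
  refine q_mul (q_pow _ Computable.fst) (c_ite (cp_eq (c_mod Computable.fst (Computable.const 2))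
    (Computable.const 0)) (hO.comp Computable.snd) (q_mul (Computable.const d) (hB.comp Computable.snd)))

theorem LL_comp (hO : Computable O) (hB : Computable B) : Computable₂ (LL O B d r) := by
  have hZ := ZZ_comp (d := d) (r := r) hO hB
  let g : Unit → List ℚ → Option ℚ := fun _ l =>
    some (if (Nat.unpair l.length).1 = 0 then O (Nat.unpair l.length).2 else
      if (Nat.unpair l.length).2 = 0 then 0 else
      min ((l[Nat.pair ((Nat.unpair l.length).1 - 1) (Nat.unpair l.length).2]?).getD 0)
        ((l[Nat.pair (Nat.unpair l.length).1 ((Nat.unpair l.length).2 - 1)]?).getD 0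
          + ZZ O B d r (Nat.unpair l.length).1 (Nat.unpair l.length).2
          - ZZ O B d r (Nat.unpair l.length).1 ((Nat.unpair l.length).2 - 1)))
  have hg : Computable₂ g := by
    have hl : Computable fun p : Unit × List ℚ => p.2 := Computable.snd
    have h0 : Computable fun p : Unit × List ℚ => Nat.unpair p.2.length :=
      Computable.unpair.comp (Computable.list_length.comp hl)
    have h1 : Computable fun p : Unit × List ℚ => (Nat.unpair p.2.length).1 := Computable.fst.comp h0
    have h2 : Computable fun p : Unit × List ℚ => (Nat.unpair p.2.length).2 := Computable.snd.comp h0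
    have h3 : Computable fun p : Unit × List ℚ => (Nat.unpair p.2.length).1 - 1 := c_sub h1 (Computable.const 1)
    have h4 : Computable fun p : Unit × List ℚ => (Nat.unpair p.2.length).2 - 1 := c_sub h2 (Computable.const 1)
    have hp : ∀ {a b : Unit × List ℚ → ℕ}, Computable a → Computable b →
        Computable fun p => ((p.2)[Nat.pair (a p) (b p)]?).getD (0 : ℚ) := fun ha hb =>
      Computable.option_getD (Computable.list_getElem?.comp hl (Primrec₂.natPair.to_comp.comp ha hb))
        (Computable.const 0)
    refine Computable.option_some.comp ?_
    refine c_ite (cp_eq h1 (Computable.const 0)) (hO.comp h2) ?_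
    refine c_ite (cp_eq h2 (Computable.const 0)) (Computable.const 0) ?_
    exact q_min (hp h3 h2) (q_sub (q_add (hp h1 h4) (hZ.comp h1 h2)) (hZ.comp h1 h4))
  have := Computable.nat_strong_rec (fun (_ : Unit) N => LL O B d r (Nat.unpair N).1 (Nat.unpair N).2) hg (by
    intro _ N
    simp only [g, List.length_map, List.length_range, List.getElem?_map]
    congr 1
    rcases h : Nat.unpair N with ⟨k, n⟩
    have hN : N = Nat.pair k n := by rw [← Nat.pair_unpair N, h]
    rcases k with _ | k
    · simp [LL]
    · rcases n with _ | n
      · simp [LL]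
      · have e1 : Nat.pair k (n + 1) < N := hN ▸ Nat.pair_lt_pair_left _ (Nat.lt_succ_self _)
        have e2 : Nat.pair (k + 1) n < N := hN ▸ Nat.pair_lt_pair_right _ (Nat.lt_succ_self _)
        simp [LL, e1, e2])
  have h2 : Computable fun p : ℕ × ℕ => LL O B d r (Nat.unpair (Nat.pair p.1 p.2)).1 (Nat.unpair (Nat.pair p.1 p.2)).2 :=
    this.comp (Computable.const ()) (Primrec₂.natPair.to_comp.comp Computable.fst Computable.snd)
  exact h2.of_eq fun p => by simp

theorem ZZ_mono (hO : Monotone O) (hB : Monotone B) (hd : 0 < d) (hr : 1 < r) (k : ℕ) :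
    Monotone (ZZ O B d r k) := by
  intro s t h
  unfold ZZ
  have h1 := hO h
  have h2 := mul_le_mul_of_nonneg_left (hB h) hd.le
  refine mul_le_mul_of_nonneg_left ?_ (by positivity)
  split_ifs <;> assumption

theorem LL_facts (hO : Monotone O) (hB : Monotone B) (hd : 0 < d) (hr : 1 < r) (hO0 : ∀ n, 0 ≤ O n) (k : ℕ) :
    Monotone (LL O B d r k) ∧ (∀ n, 0 ≤ LL O B d r k n) ∧ ∀ n, LL O B d r k n ≤ O n := by
  induction k with
  | zero => 
    have : LL O B d r 0 = O := by ext n; simp [LL]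
    rw [this]; exact ⟨hO, hO0, fun n => le_rfl⟩
  | succ k ih =>
    obtain ⟨i1, i2, i3⟩ := ih
    have hle : ∀ n, LL O B d r (k + 1) n ≤ LL O B d r k n := by
      intro n
      cases n with
      | zero => simpa [LL] using i2 0
      | succ n => rw [LL]; exact min_le_left _ _
    have hm : Monotone (LL O B d r (k + 1)) := by
      refine monotone_nat_of_le_succ fun n => ?_
      conv_rhs => rw [LL]
      refine le_min ((hle n).trans (i1 (Nat.le_succ n))) ?_
      have := ZZ_mono hO hB hd hr (k + 1) (Nat.le_succ n)
      simp only [Nat.succ_eq_add_one] at this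
      linarith
    refine ⟨hm, fun n => ?_, fun n => (hle n).trans (i3 n)⟩
    have := hm (Nat.zero_le n)
    simpa [LL] using this

theorem LL_eventually {Om Bl : ℝ} 
    (hOm : Tendsto (fun n => (O n : ℝ)) atTop (nhds Om)) (hBl : Tendsto (fun n => (B n : ℝ)) atTop (nhds Bl))
    (hr : 1 < r)
    (h0 : ∃ᶠ n in atTop, r * (Om - O n) < d * (Bl - B n)) 
    (h1 : ∃ᶠ n in atTop, r * (d * (Bl - B n)) < (Om - O n)) (k : ℕ) :
    ∃ n0 c, ∀ n ≥ n0, LL O B d r k n = ZZ O B d r k n + c := by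
  have hr0 : (0 : ℝ) < r := by exact_mod_cast (by linarith : (0 : ℚ) < r)
  let zl : ℕ → ℝ := fun k => r ^ k * (if k % 2 = 0 then Om else d * Bl)
  have hZl : ∀ k, Tendsto (fun n => (ZZ O B d r k n : ℝ)) atTop (nhds (zl k)) := by
    intro k
    simp only [ZZ, zl]
    push_cast
    apply Tendsto.const_mul
    split_ifs
    · exact hOm
    · push_cast; exact hBl.const_mul _
  have hfr : ∀ k, ∃ᶠ n in atTop, zl (k + 1) - ZZ O B d r (k + 1) n < zl k - ZZ O B d r k n := by
    intro k
    have hp : (0 : ℝ) < (r : ℝ) ^ k := by positivity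
    simp only [ZZ, zl]
    rcases Nat.mod_two_eq_zero_or_one k with h | h
    · have h' : (k + 1) % 2 ≠ 0 := by omega
      simp only [h, h', if_true, if_false]
      refine h1.mono fun n hn => ?_
      push_cast
      rw [pow_succ]
      have := mul_lt_mul_of_pos_left hn hp
      linarith
    · have h' : (k + 1) % 2 = 0 := by omega
      have h'' : ¬ k % 2 = 0 := by omega
      simp only [h', h'', if_true, if_false]
      refine h0.mono fun n hn => ?_
      push_cast
      rw [pow_succ]
      have := mul_lt_mul_of_pos_left hn hp
      linarith
  induction k with
  | zero => exact ⟨0, 0, fun n _ => by simp [LL, ZZ]⟩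
  | succ k ih =>
    obtain ⟨n0, c, hc⟩ := ih
    let A : ℕ → ℚ := fun n => LL O B d r k n - ZZ O B d r (k + 1) n
    let e : ℕ → ℚ := fun n => LL O B d r (k + 1) n - ZZ O B d r (k + 1) n
    have he : ∀ n, e (n + 1) = min (A (n + 1)) (e n) := by
      intro n
      simp only [e, A]
      rw [LL, ← min_sub_sub_right]
      congr 1
      ring
    have hA : Tendsto (fun n => (A n : ℝ)) atTop (nhds (zl k + c - zl (k + 1))) := by
      refine (((hZl k).add_const (c : ℝ)).sub (hZl (k + 1))).congr' ?_
      filter_upwards [eventually_ge_atTop n0] with n hn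
      simp only [A]
      rw [hc n hn]; push_cast; ring
    obtain ⟨n1, hn1, hlt⟩ := (frequently_atTop.1 (hfr k)) (n0 + 1)
    have hA1 : (A n1 : ℝ) < zl k + c - zl (k + 1) := by
      simp only [A]
      rw [hc n1 (by omega)]; push_cast; linarith
    have hev := hA.eventually_const_lt hA1
    obtain ⟨n2, hn2⟩ := eventually_atTop.1 hev
    have hanti : Antitone e := antitone_nat_of_succ_le fun n => by rw [he]; exact min_le_right _ _
    let N := max n1 n2
    refine ⟨N, e N, fun n hn => ?_⟩
    have : e n = e N := by
      induction n, hn using Nat.le_induction with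
      | base => rfl
      | succ n hn ih =>
        rw [he, ih, min_eq_right]
        have h1 : e N ≤ e n1 := hanti (le_max_left _ _)
        have h2 : e n1 ≤ A n1 := by
          obtain ⟨q, rfl⟩ : ∃ q, n1 = q + 1 := ⟨n1 - 1, by omega⟩
          rw [he]; exact min_le_left _ _
        have h3 : A n1 ≤ A (n + 1) := by
          have hn' : n2 ≤ n + 1 := le_trans (le_max_right n1 n2) (Nat.le_succ_of_le hn)
          have := hn2 (n + 1) hn'
          exact_mod_cast this.le
        exact h1.trans (h2.trans h3)
    rw [← this]
    simp [e]

theorem dichotomy {Om Bl : ℝ} (hOc : Computable O) (hBc : Computable B)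
    (hO : Monotone O) (hB : Monotone B) (hO0 : ∀ n, 0 ≤ O n) (hO1 : ∀ n, O n ≤ 1)
    (hOm : Tendsto (fun n => (O n : ℝ)) atTop (nhds Om)) (hBl : Tendsto (fun n => (B n : ℝ)) atTop (nhds Bl))
    (hT : TFam O Om) (hd : 0 < d) (hr : 1 < r) :
    (∀ᶠ n in atTop, d * (Bl - B n) ≤ r * (Om - O n)) ∨
    (∀ᶠ n in atTop, (Om - O n) ≤ r * (d * (Bl - B n))) := by
  by_contra hcon
  rw [not_or, not_eventually, not_eventually] at hcon
  simp only [not_le] at hcon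
  obtain ⟨h0, h1⟩ := hcon
  obtain ⟨p, hp⟩ : ∃ p : ℕ, (2 : ℝ) < (r : ℝ) ^ p := 
    pow_unbounded_of_one_lt _ (by exact_mod_cast hr)
  have hr0 : (0 : ℝ) < r := by exact_mod_cast (by linarith : (0 : ℚ) < r)
  have hf := fun k => LL_facts hO hB hd hr hO0 k
  obtain ⟨C, hC, hCT⟩ := hT (fun j t => LL O B d r (2 * p * j) t)
    ((LL_comp hOc hBc).comp (c_mul (Computable.const (2 * p)) Computable.fst) Computable.snd)
    (fun j => (hf _).1) (fun j t => (hf _).2.1 t) (fun j t => ((hf _).2.2 t).trans (hO1 t))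
  have key : ∀ j, (2 : ℝ) ^ j ≤ C := by
    intro j
    obtain ⟨n0, c, hc⟩ := LL_eventually hOm hBl hr h0 h1 (2 * p * j)
    have hZ : ∀ n, ZZ O B d r (2 * p * j) n = r ^ (2 * p * j) * O n := by
      intro n
      have : (2 * p * j) % 2 = 0 := by rw [mul_assoc]; omega
      simp [ZZ, this]
    have hlim : Tendsto (fun t => (r : ℝ) ^ (2 * p * j) * ((O t : ℝ) - O n0)) atTop
        (nhds ((r : ℝ) ^ (2 * p * j) * (Om - O n0))) := (hOm.sub_const _).const_mul _
    have h3 : (r : ℝ) ^ (2 * p * j) * (Om - O n0) ≤ C * 2 ^ j * (Om - O n0) := by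
      refine le_of_tendsto hlim ?_
      filter_upwards [eventually_ge_atTop n0] with t ht
      have := hCT j n0 t
      rw [hc t ht, hc n0 le_rfl, hZ, hZ] at this
      push_cast at this
      linarith
    have h4 := le_of_mul_le_mul_right h3 (sub_pos.2 (tfam_strict hT n0))
    have h5 : (4 : ℝ) ^ j ≤ (r : ℝ) ^ (2 * p * j) := by
      rw [pow_mul]
      gcongr
      rw [mul_comm, pow_mul]
      nlinarith
    have h6 : (2 : ℝ) ^ j * 2 ^ j ≤ C * 2 ^ j := by
      rw [← mul_pow]; norm_num; linarith
    exact le_of_mul_le_mul_right h6 (by positivity)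
  obtain ⟨j, hj⟩ := pow_unbounded_of_one_lt C (by norm_num : (1 : ℝ) < 2)
  linarith [key j]

end dich
end OmegaPf


namespace OmegaPf

section game
variable (a : ℕ → ℚ) (c0 p : ℕ)

abbrev St := List (ℕ × ℕ) × ℚ × ℚ

def theta (j : ℕ) : ℚ := (1 / (p : ℚ)) * (1 / 4) ^ j

def gstep (j t : ℕ) (st : St) : St :=
  Option.casesOn (motive := fun _ => St) st.1.head? st fun x =>
    if x.1 = 0 then (if a t ≤ st.2.1 - theta p j * (1 / 2) ^ x.2 then (st.1.tail, a t, st.2.2) else st)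
    else if x.1 = 1 then ((0, x.2) :: st.1.tail, st.2.1, st.2.2 + (1 / 2) ^ x.2)
    else (List.replicate (2 ^ (t + c0 + 1)) (x.1 - 1, x.2 + (t + c0 + 1)) ++ st.1.tail, st.2.1, st.2.2)

def run (j : ℕ) : ℕ → St
  | 0 => ([(2 * 4 ^ j * p + 2, 0)], a 0, 0)
  | t + 1 => gstep a c0 p j t (run j t)

variable {a c0 p}

theorem c_replicate {α β : Type*} [Primcodable α] [Primcodable β] {f : α → ℕ} {g : α → β}
    (hf : Computable f) (hg : Computable g) : Computable fun x => List.replicate (f x) (g x) := by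
  refine (Computable.nat_rec (f := f) (g := fun _ => ([] : List β))
       (h := fun x p => g x :: p.2) hf (Computable.const _) ?_).of_eq ?_
  · exact Computable.list_cons.comp (hg.comp Computable.fst) (Computable.snd.comp Computable.snd)
  · intro x
    generalize f x = n
    induction n with
    | zero => simp
    | succ n ih => simp only [ih, List.replicate_succ]

theorem gstep_comp (ha : Computable a) :
    Computable fun x : (ℕ × ℕ) × St => gstep a c0 p x.1.1 x.1.2 x.2 := by
  unfold gstep
  have hst : Computable fun x : (ℕ × ℕ) × St => x.2 := Computable.snd
  have hs1 : Computable fun x : (ℕ × ℕ) × St => x.2.1 := Computable.fst.comp hst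
  refine Computable.option_casesOn (o := fun x : (ℕ × ℕ) × St => x.2.1.head?)
    (f := fun x => x.2) (g := fun s x => if x.1 = 0 then (if a s.1.2 ≤ s.2.2.1 - theta p s.1.1 * (1 / 2) ^ x.2 then (s.2.1.tail, a s.1.2, s.2.2.2) else s.2)
    else if x.1 = 1 then ((0, x.2) :: s.2.1.tail, s.2.2.1, s.2.2.2 + (1 / 2) ^ x.2)
    else (List.replicate (2 ^ (s.1.2 + c0 + 1)) (x.1 - 1, x.2 + (s.1.2 + c0 + 1)) ++ s.2.1.tail, s.2.2.1, s.2.2.2))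
    (Primrec.list_head?.to_comp.comp hs1) hst ?_
  have k0 : Computable fun y : ((ℕ × ℕ) × St) × (ℕ × ℕ) => y.1 := Computable.fst
  have kst : Computable fun y : ((ℕ × ℕ) × St) × (ℕ × ℕ) => y.1.2 := Computable.snd.comp k0
  have kl : Computable fun y : ((ℕ × ℕ) × St) × (ℕ × ℕ) => y.1.2.1.tail :=
    Primrec.list_tail.to_comp.comp (Computable.fst.comp kst)
  have kq : Computable fun y : ((ℕ × ℕ) × St) × (ℕ × ℕ) => y.1.2.2 := Computable.snd.comp kst
  have kr : Computable fun y : ((ℕ × ℕ) × St) × (ℕ × ℕ) => y.1.2.2.1 := Computable.fst.comp kq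
  have km : Computable fun y : ((ℕ × ℕ) × St) × (ℕ × ℕ) => y.1.2.2.2 := Computable.snd.comp kq
  have kj : Computable fun y : ((ℕ × ℕ) × St) × (ℕ × ℕ) => y.1.1.1 := Computable.fst.comp (Computable.fst.comp k0)
  have kt : Computable fun y : ((ℕ × ℕ) × St) × (ℕ × ℕ) => y.1.1.2 := Computable.snd.comp (Computable.fst.comp k0)
  have kh : Computable fun y : ((ℕ × ℕ) × St) × (ℕ × ℕ) => y.2.1 := Computable.fst.comp Computable.snd
  have ke : Computable fun y : ((ℕ × ℕ) × St) × (ℕ × ℕ) => y.2.2 := Computable.snd.comp Computable.snd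
  have kat := ha.comp kt
  have kp : Computable fun y : ((ℕ × ℕ) × St) × (ℕ × ℕ) => (1 / 2 : ℚ) ^ y.2.2 := q_pow _ ke
  have kth : Computable fun y : ((ℕ × ℕ) × St) × (ℕ × ℕ) => theta p y.1.1.1 :=
    q_mul (Computable.const _) (q_pow _ kj)
  have kb : Computable fun y : ((ℕ × ℕ) × St) × (ℕ × ℕ) => y.1.1.2 + c0 + 1 :=
    c_add (c_add kt (Computable.const c0)) (Computable.const 1)
  refine c_ite (cp_eq kh (Computable.const 0)) ?_ (c_ite (cp_eq kh (Computable.const 1)) ?_ ?_)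
  · exact c_ite (q_le kat (q_sub kr (q_mul kth kp))) (kl.pair (kat.pair km)) kst
  · exact (Computable.list_cons.comp ((Computable.const 0).pair ke) kl).pair (kr.pair (q_add km kp))
  · exact (Computable.list_append.comp (c_replicate (c_npow 2 kb) ((c_sub kh (Computable.const 1)).pair
      (c_add ke kb))) kl).pair (kr.pair km)

theorem run_comp (ha : Computable a) : Computable₂ (run a c0 p) := by
  have h1 : Computable fun x : ℕ × ℕ => 2 * 4 ^ x.1 * p + 2 :=
    c_add (c_mul (c_mul (Computable.const 2) (c_npow 4 Computable.fst)) (Computable.const p))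
      (Computable.const 2)
  have h2 : Computable fun x : ℕ × ℕ => ((2 * 4 ^ x.1 * p + 2, 0) : ℕ × ℕ) :=
    h1.pair (Computable.const 0)
  have h3 : Computable fun x : ℕ × ℕ => [((2 * 4 ^ x.1 * p + 2, 0) : ℕ × ℕ)] :=
    Computable.list_cons.comp h2 (Computable.const [])
  have hinit : Computable fun x : ℕ × ℕ => (([(2 * 4 ^ x.1 * p + 2, 0)], a 0, 0) : St) :=
    h3.pair (Computable.const (a 0, (0 : ℚ)))
  have hstep : Computable₂ fun (x : ℕ × ℕ) (y : ℕ × St) => gstep a c0 p x.1 y.1 y.2 := by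
    have e : Computable fun z : (ℕ × ℕ) × (ℕ × St) => ((z.1.1, z.2.1), z.2.2) :=
      ((Computable.fst.comp Computable.fst).pair (Computable.fst.comp Computable.snd)).pair
        (Computable.snd.comp Computable.snd)
    have h := Computable.comp (gstep_comp (a := a) (c0 := c0) (p := p) ha) e
    refine h.of_eq ?_
    intro z
    simp only
  have h := Computable.nat_rec (α := ℕ × ℕ) (σ := St) (f := fun x => x.2) Computable.snd hinit hstep
  refine h.of_eq ?_
  rintro ⟨j, t⟩
  simp only
  induction t with
  | zero => rfl
  | succ t ih => simp only [ih, run]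

def pot (L : List (ℕ × ℕ)) : ℚ := (L.map fun x => if x.1 = 0 then 0 else (1 / 2 : ℚ) ^ x.2).sum

theorem pot_nonneg (L : List (ℕ × ℕ)) : 0 ≤ pot L := by
  apply List.sum_nonneg
  intro x hx
  simp only [List.mem_map] at hx
  obtain ⟨y, -, rfl⟩ := hx
  split_ifs <;> positivity

theorem gstep_nil (j t : ℕ) (q m : ℚ) : gstep a c0 p j t ([], q, m) = ([], q, m) := rfl

theorem gstep_zero (j t e : ℕ) (L) (q m : ℚ) : gstep a c0 p j t ((0, e) :: L, q, m) =
    if a t ≤ q - theta p j * (1 / 2) ^ e then (L, a t, m) else ((0, e) :: L, q, m) := by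
  simp [gstep]

theorem gstep_one (j t e : ℕ) (L) (q m : ℚ) : gstep a c0 p j t ((1, e) :: L, q, m) =
    ((0, e) :: L, q, m + (1 / 2) ^ e) := by
  simp [gstep]

theorem gstep_two (j t h e : ℕ) (L) (q m : ℚ) : gstep a c0 p j t ((h + 2, e) :: L, q, m) =
    (List.replicate (2 ^ (t + c0 + 1)) (h + 1, e + (t + c0 + 1)) ++ L, q, m) := by
  simp [gstep]

theorem gstep_inv (j t : ℕ) (st : St) : st.2.2 ≤ (gstep a c0 p j t st).2.2 ∧
    (gstep a c0 p j t st).2.2 + pot (gstep a c0 p j t st).1 = st.2.2 + pot st.1 := by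
  obtain ⟨L, q, m⟩ := st
  rcases L with _ | ⟨⟨h, e⟩, L⟩
  · rw [gstep_nil]; simp
  · rcases h with _ | _ | h
    · rw [gstep_zero]
      split_ifs <;> simp [pot]
    · rw [gstep_one]
      refine ⟨?_, ?_⟩
      · simp
      · simp [pot]; ring
    · rw [gstep_two]
      refine ⟨le_rfl, ?_⟩
      simp [pot]
      rw [pow_add (2 : ℚ) e]
      field_simp

theorem run_mono (j : ℕ) : Monotone fun t => (run a c0 p j t).2.2 :=
  monotone_nat_of_le_succ fun t => (gstep_inv j t _).1

theorem run_inv (j t : ℕ) : (run a c0 p j t).2.2 + pot (run a c0 p j t).1 = 1 := by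
  induction t with
  | zero => simp [run, pot]
  | succ t ih => rw [run, (gstep_inv j t _).2, ih]

theorem run_le (j t : ℕ) : (run a c0 p j t).2.2 ≤ 1 := by
  have := run_inv (a := a) (c0 := c0) (p := p) j t
  have := pot_nonneg (run a c0 p j t).1
  linarith

theorem run_nonneg (j t : ℕ) : 0 ≤ (run a c0 p j t).2.2 := run_mono (a := a) (c0 := c0) (p := p) j (Nat.zero_le t)

theorem W_union {A B : Finset (List Bool)} (h : Disjoint A B) : W (A ∪ B) = W A + W B :=
  Finset.sum_union h

theorem round_ineq {P S : ℕ → Finset (List Bool)} (hP : Monotone P) (hS : Monotone S)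
    (hSP : ∀ n, S n ⊆ P n) {r0 r s : ℕ} (h0 : r0 ≤ r) (h1 : r ≤ s) {x y : ℚ} (hy : 0 ≤ y)
    (hx : x ≤ W (S s \ P r)) (hd : (W (P s) - W (S s)) ≤ (W (P r) - W (S r)) - y) :
    x + y ≤ W (S s \ P r0) - W (S r \ P r0) +
      (((S s ∩ P r0).card : ℚ) - (S r ∩ P r0).card) * y := by
  classical
  have hSrs := hS h1
  have hPrs := hP h1
  have hP0r := hP h0
  have e1 : W (S s) = W (S r) + W (S s \ S r) := by
    rw [← W_union Finset.disjoint_sdiff, Finset.union_sdiff_of_subset hSrs]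
  have e2 : W (P s) = W (P r) + W (P s \ P r) := by
    rw [← W_union Finset.disjoint_sdiff, Finset.union_sdiff_of_subset hPrs]
  have e3 : W (S s \ S r) ≤ W ((S s \ S r) ∩ P r) + W (P s \ P r) := by
    rw [← W_union]
    · apply W_mono
      intro σ hσ
      have := hSP s (Finset.mem_sdiff.1 hσ).1
      by_cases h : σ ∈ P r <;> simp_all
    · rw [Finset.disjoint_left]; intro σ; simp; tauto
  have e4 : y ≤ W ((S s \ S r) ∩ P r) := by linarith
  have cm : S r ∩ P r0 ⊆ S s ∩ P r0 := Finset.inter_subset_inter_right hSrs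
  have d1 : Disjoint (S r \ P r0) (S s \ P r) := by
    rw [Finset.disjoint_left]; intro σ h1 h2
    exact (Finset.mem_sdiff.1 h2).2 (hSP r (Finset.mem_sdiff.1 h1).1)
  have s1 : (S r \ P r0) ∪ (S s \ P r) ⊆ S s \ P r0 := by
    intro σ hσ
    rcases Finset.mem_union.1 hσ with h | h
    · exact Finset.mem_sdiff.2 ⟨hSrs (Finset.mem_sdiff.1 h).1, (Finset.mem_sdiff.1 h).2⟩
    · exact Finset.mem_sdiff.2 ⟨(Finset.mem_sdiff.1 h).1, fun h' => (Finset.mem_sdiff.1 h).2 (hP0r h')⟩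
  by_cases hc : (S s ∩ P r0).card = (S r ∩ P r0).card
  · have heq : S r ∩ P r0 = S s ∩ P r0 := Finset.eq_of_subset_of_card_le cm hc.le
    have nin : ∀ σ ∈ (S s \ S r) ∩ P r, σ ∉ P r0 := by
      intro σ hσ h
      have h1 := Finset.mem_sdiff.1 (Finset.mem_inter.1 hσ).1
      have : σ ∈ S r ∩ P r0 := heq ▸ Finset.mem_inter.2 ⟨h1.1, h⟩
      exact h1.2 (Finset.mem_inter.1 this).1
    have d2 : Disjoint ((S r \ P r0) ∪ (S s \ P r)) ((S s \ S r) ∩ P r) := by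
      rw [Finset.disjoint_left]; intro σ; simp; tauto
    have s2 : ((S r \ P r0) ∪ (S s \ P r)) ∪ ((S s \ S r) ∩ P r) ⊆ S s \ P r0 := by
      apply Finset.union_subset s1
      intro σ hσ
      exact Finset.mem_sdiff.2 ⟨(Finset.mem_sdiff.1 (Finset.mem_inter.1 hσ).1).1, nin σ hσ⟩
    have := W_mono s2
    rw [W_union d2, W_union d1] at this
    rw [hc]
    linarith
  · have hlt : (S r ∩ P r0).card + 1 ≤ (S s ∩ P r0).card :=
      lt_of_le_of_ne (Finset.card_le_card cm) (Ne.symm hc)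
    have hlt' : ((S r ∩ P r0).card : ℚ) + 1 ≤ (S s ∩ P r0).card := by exact_mod_cast hlt
    have := W_mono s1
    rw [W_union d1] at this
    have h3 : 1 * y ≤ (((S s ∩ P r0).card : ℚ) - (S r ∩ P r0).card) * y := 
      mul_le_mul_of_nonneg_right (by linarith) hy
    linarith

theorem game {P S : ℕ → Finset (List Bool)} (hP : Monotone P) (hS : Monotone S)
    (hSP : ∀ n, S n ⊆ P n) (hcard : ∀ n, (P n).card ≤ n + c0) (hP1 : ∀ n, W (P n) ≤ 1)
    (haeq : ∀ n, a n = W (P n) - W (S n)) (ha : Computable a) {α Om : ℝ}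
    (hal : Tendsto (fun n => (a n : ℝ)) atTop (nhds α)) 
    (hT : TFam (fun n => W (P n)) Om) (hp : 0 < p)
    (hyp : ∀ n, (1 / p : ℝ) * (Om - W (P n)) ≤ a n - α) : False := by
  obtain ⟨C, hC, hCT⟩ := hT (fun j t => (run a c0 p j t).2.2)
    (Computable.snd.comp (Computable.snd.comp (run_comp ha))) run_mono run_nonneg run_le
  obtain ⟨j, hj⟩ := pow_unbounded_of_one_lt C (by norm_num : (1 : ℝ) < 2)
  have hpq : (0 : ℚ) < p := by exact_mod_cast hp
  have hpr : (0 : ℝ) < p := by exact_mod_cast hp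
  have hth : 0 < theta p j := by unfold theta; positivity
  set θ := theta p j with hθ
  -- response
  have resp : ∀ t r e : ℕ, r ≤ t → (run a c0 p j (t + 1)).2.2 = (run a c0 p j t).2.2 + (1 / 2) ^ e →
      α < (a r - θ * (1 / 2) ^ e : ℚ) := by
    intro t r e hrt hm
    have h1 := hCT j t (t + 1)
    simp only at h1
    rw [hm] at h1
    push_cast at h1
    have h2 := hyp r
    have h3 : (W (P r) : ℝ) ≤ W (P t) := by exact_mod_cast W_mono (hP hrt)
    have h4 : (1 / 2 : ℝ) ^ e ≤ C * 2 ^ j * (Om - W (P r)) := by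
      have : C * 2 ^ j * (Om - W (P t)) ≤ C * 2 ^ j * (Om - W (P r)) := by gcongr
      linarith
    have hpos : (0 : ℝ) < Om - W (P r) := by
      have : (0 : ℝ) < (1 / 2 : ℝ) ^ e := by positivity
      exact pos_of_mul_pos_right (this.trans_le h4) (by positivity)
    have h5 : (1 / 2 : ℝ) ^ e < 4 ^ j * (Om - W (P r)) := by
      have : C * 2 ^ j < 2 ^ j * 2 ^ j := by gcongr
      rw [← mul_pow] at this
      norm_num at this
      calc _ ≤ _ := h4
        _ < _ := by gcongr
    have h6 : (θ : ℝ) * (1 / 2) ^ e < 1 / p * (Om - W (P r)) := by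
      rw [hθ, theta]
      push_cast
      rw [mul_assoc]
      gcongr
      rw [one_div_pow, one_div, inv_mul_lt_iff₀ (by positivity)]
      exact h5
    push_cast
    linarith
  have E : ∀ (h t e : ℕ) (L : List (ℕ × ℕ)) (r : ℕ) (μ : ℚ), r ≤ t → run a c0 p j t = ((h + 1, e) :: L, a r, μ) →
      ∃ s T μ', r ≤ s ∧ s ≤ T ∧ run a c0 p j T = (L, a s, μ') ∧ a s ≤ a r - θ * (1 / 2) ^ e ∧
        (h : ℚ) * θ * (1 / 2) ^ e / 2 ≤ W (S s \ P r) := by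
    intro h
    induction h with
    | zero =>
      intro t e L r μ hrt hrun
      have hrun1 : run a c0 p j (t + 1) = ((0, e) :: L, a r, μ + (1 / 2) ^ e) := by
        rw [run, hrun, gstep_one]
      have hlt := resp t r e hrt (by rw [hrun1, hrun])
      have hev := hal.eventually_lt_const hlt
      have hex : ∃ u, t + 1 ≤ u ∧ a u ≤ a r - θ * (1 / 2) ^ e := by
        obtain ⟨N, hN⟩ := eventually_atTop.1 hev
        have := hN (max N (t + 1)) (le_max_left _ _)
        exact ⟨max N (t + 1), le_max_right _ _, by exact_mod_cast this.le⟩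
      classical
      let u := Nat.find hex
      have hu := Nat.find_spec hex
      have hstay : ∀ v, t + 1 ≤ v → v ≤ u → run a c0 p j v = ((0, e) :: L, a r, μ + (1 / 2) ^ e) := by
        intro v hv
        induction v, hv using Nat.le_induction with
        | base => intro _; exact hrun1
        | succ v hv ih =>
          intro hvu
          rw [run, ih (by omega), gstep_zero, if_neg]
          intro hcon
          exact Nat.find_min hex (show v < Nat.find hex from hvu) ⟨hv, hcon⟩
      refine ⟨u, u + 1, μ + (1 / 2) ^ e, ?_, Nat.le_succ _, ?_, hu.2, ?_⟩
      · have : t + 1 ≤ u := hu.1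
        omega
      · rw [run, hstay u hu.1 le_rfl, gstep_zero, if_pos hu.2]
      · simpa using W_nonneg _
    | succ h ih =>
      intro t e L r μ hrt hrun
      set b := t + c0 + 1 with hb
      have hrun1 : run a c0 p j (t + 1) = (List.replicate (2 ^ b) (h + 1, e + b) ++ L, a r, μ) := by
        rw [run, hrun, gstep_two]
      have hq0 : (0 : ℚ) < θ * (1 / 2) ^ (e + b) := by positivity
      have rounds : ∀ (n T r' : ℕ) (μ : ℚ), r ≤ r' → r' ≤ T →
          run a c0 p j T = (List.replicate n (h + 1, e + b) ++ L, a r', μ) →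
          ∃ s T' μ', r' ≤ s ∧ s ≤ T' ∧ run a c0 p j T' = (L, a s, μ') ∧
            a s ≤ a r' - (n : ℚ) * (θ * (1 / 2) ^ (e + b)) ∧
            (n : ℚ) * (h * θ * (1 / 2) ^ (e + b) / 2 + θ * (1 / 2) ^ (e + b)) ≤
              W (S s \ P r) - W (S r' \ P r) + 
              (((S s ∩ P r).card : ℚ) - (S r' ∩ P r).card) * (θ * (1 / 2) ^ (e + b)) := by
        intro n
        induction n with
        | zero =>
          intro T r' μ h1 h2 h3
          exact ⟨r', T, μ, le_rfl, h2, by simpa using h3, by simp, by simp⟩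
        | succ n ihn =>
          intro T r' μ h1 h2 h3
          rw [List.replicate_succ, List.cons_append] at h3
          obtain ⟨s, T1, μ1, g1, g2, g3, g4, g5⟩ := ih T (e + b) _ r' μ h2 h3
          obtain ⟨s', T2, μ2, f1, f2, f3, f4, f5⟩ := ihn T1 s μ1 (h1.trans g1) g2 g3
          refine ⟨s', T2, μ2, g1.trans f1, f2, f3, ?_, ?_⟩
          · push_cast; linarith
          · have := round_ineq hP hS hSP h1 g1 hq0.le g5 (by rw [← haeq, ← haeq]; exact g4)
            push_cast; linarith
      obtain ⟨s, T, μ', f1, f2, f3, f4, f5⟩ := rounds (2 ^ b) (t + 1) r μ le_rfl (by omega) hrun1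
      have hN : ((2 ^ b : ℕ) : ℚ) * (1 / 2) ^ (e + b) = (1 / 2) ^ e := by
        push_cast
        rw [pow_add, one_div_pow, one_div_pow]; field_simp; rw [hb]; ring
      refine ⟨s, T, μ', f1, f2, f3, ?_, ?_⟩
      · rw [← hN]; linarith
      · have z1 : W (S r \ P r) = 0 := by
          rw [Finset.sdiff_eq_empty_iff_subset.2 (hSP r)]; simp [W]
        rw [z1] at f5
        have hc1 : (S s ∩ P r).card ≤ b := by
          calc _ ≤ (P r).card := Finset.card_le_card Finset.inter_subset_right
            _ ≤ r + c0 := hcard r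
            _ ≤ b := by omega
        have hc2 : 2 * b ≤ 2 ^ b := by
          have : ∀ n, 2 * (n + 1) ≤ 2 ^ (n + 1) := by
            intro n; induction n with
            | zero => simp
            | succ n ih => rw [pow_succ]; omega
          exact this (t + c0)
        have hc3 : 2 * ((S s ∩ P r).card : ℚ) ≤ (2 ^ b : ℕ) := by
          exact_mod_cast (by omega : 2 * (S s ∩ P r).card ≤ 2 ^ b)
        have hc4 : (0 : ℚ) ≤ ((S r ∩ P r).card : ℚ) := by positivity
        have h7 : (((S s ∩ P r).card : ℚ) - (S r ∩ P r).card) * (θ * (1 / 2) ^ (e + b)) ≤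
            ((2 ^ b : ℕ) : ℚ) / 2 * (θ * (1 / 2) ^ (e + b)) :=
          mul_le_mul_of_nonneg_right (by linarith) hq0.le
        have h8 : ((2 ^ b : ℕ) : ℚ) / 2 * (θ * (1 / 2) ^ (e + b)) = θ * (1 / 2) ^ e / 2 := by
          rw [← hN]; ring
        have h9 : ((2 ^ b : ℕ) : ℚ) * (h * θ * (1 / 2) ^ (e + b) / 2 + θ * (1 / 2) ^ (e + b))
          = h * θ * (1 / 2) ^ e / 2 + θ * (1 / 2) ^ e := by
          rw [← hN]; ring
        rw [h9] at f5
        rw [h8] at h7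
        push_cast
        linarith
  obtain ⟨s, T, μ', -, -, -, -, h5⟩ := E (2 * 4 ^ j * p + 1) 0 0 [] 0 0 le_rfl rfl
  have h6 : W (S s \ P 0) ≤ 1 := (W_mono (Finset.sdiff_subset.trans (hSP s))).trans (hP1 s)
  have h7 : ((2 * 4 ^ j * p + 1 : ℕ) : ℚ) * θ * (1 / 2) ^ 0 / 2 = 1 + θ / 2 := by
    rw [hθ, theta]; push_cast; rw [one_div_pow]; field_simp
  linarith

end game
end OmegaPf


namespace OmegaPf

def rmax (a : ℕ → ℚ) : ℕ → ℚ
  | 0 => a 0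
  | n + 1 => max (rmax a n) (a (n + 1))

theorem rmax_comp {a : ℕ → ℚ} (ha : Computable a) : Computable (rmax a) := by
  have hs : Computable₂ fun (_ : ℕ) (p : ℕ × ℚ) => max p.2 (a (p.1 + 1)) :=
    q_max (Computable.snd.comp Computable.snd)
      (ha.comp (Computable.succ.comp (Computable.fst.comp Computable.snd)))
  refine (Computable.nat_rec (f := fun n : ℕ => n) Computable.id (Computable.const (a 0)) hs).of_eq ?_
  intro n
  induction n with
  | zero => rfl
  | succ n ih => simp only [rmax]; rw [← ih]

theorem rmax_mono (a : ℕ → ℚ) : Monotone (rmax a) :=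
  monotone_nat_of_le_succ fun _ => le_max_left _ _

theorem le_rmax (a : ℕ → ℚ) (n : ℕ) : a n ≤ rmax a n := by
  cases n with
  | zero => exact le_rfl
  | succ n => exact le_max_right _ _

theorem rmax_eq (a : ℕ → ℚ) (n : ℕ) : ∃ i ≤ n, rmax a n = a i := by
  induction n with
  | zero => exact ⟨0, le_rfl, rfl⟩
  | succ n ih =>
    obtain ⟨i, hi, h⟩ := ih
    rcases max_choice (rmax a n) (a (n + 1)) with h' | h'
    · exact ⟨i, by omega, h'.trans h⟩
    · exact ⟨n + 1, le_rfl, h'⟩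

theorem meas_bound {b : ℕ → ℚ} (hb : Monotone b) {V : Set ℝ} {q : ℚ} (hq : 0 ≤ q)
    (hV : volume V ≤ ENNReal.ofReal q) (A : Finset ℕ)
    (hA : ∀ n ∈ A, Set.Ico (b n : ℝ) (b (n + 1)) ⊆ V) :
    ∑ n ∈ A, (b (n + 1) - b n) ≤ q := by
  have hbr : Monotone fun n => (b n : ℝ) := fun i j h => Rat.cast_le.2 (hb h)
  have hd := hbr.pairwise_disjoint_on_Ico_succ
  simp only [Order.succ_eq_add_one] at hd
  have h1 : volume (⋃ n ∈ A, Set.Ico (b n : ℝ) (b (n + 1))) = 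
      ∑ n ∈ A, volume (Set.Ico (b n : ℝ) (b (n + 1))) :=
    measure_biUnion_finset (fun i _ j _ hij => hd hij) (fun n _ => measurableSet_Ico)
  have h2 : volume (⋃ n ∈ A, Set.Ico (b n : ℝ) (b (n + 1))) ≤ ENNReal.ofReal q :=
    (measure_mono (Set.iUnion₂_subset hA)).trans hV
  rw [h1] at h2
  simp only [Real.volume_Ico] at h2
  have hnn : ∀ n ∈ A, (0 : ℝ) ≤ (b (n + 1) : ℝ) - b n := fun n _ => sub_nonneg.2 (hbr (Nat.le_succ n))
  rw [← ENNReal.ofReal_sum_of_nonneg hnn,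
    ENNReal.ofReal_le_ofReal_iff (by exact_mod_cast hq)] at h2
  exact_mod_cast h2

theorem finish {a O : ℕ → ℚ} {α Om k : ℝ} (ha : Computable a)
    (hal : Tendsto (fun n => (a n : ℝ)) atTop (nhds α)) (hO : Monotone O) (hk : 0 < k)
    (hyp : ∀ n, k * (Om - O n) ≤ α - a n) (hT : TFam O Om) : LeftCE α ∧ MLRandom α := by
  classical
  have hbc := rmax_comp ha
  have hbm := rmax_mono a
  have hble := le_rmax a
  have hbk : ∀ n, k * (Om - O n) ≤ α - rmax a n := by
    intro n
    obtain ⟨i, hi, h⟩ := rmax_eq a n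
    rw [h]
    refine le_trans ?_ (hyp i)
    have : (O i : ℝ) ≤ O n := by exact_mod_cast hO hi
    gcongr
  generalize rmax a = b at *
  have hbα : ∀ n, (b n : ℝ) < α := by
    intro n
    have h1 := hbk n
    have h2 := tfam_strict hT n
    have : 0 < k * (Om - O n) := mul_pos hk (by linarith)
    linarith
  have hbl : Tendsto (fun n => (b n : ℝ)) atTop (nhds α) :=
    tendsto_of_tendsto_of_tendsto_of_le_of_le hal tendsto_const_nhds
      (fun n => Rat.cast_le.2 (hble n)) (fun n => (hbα n).le)
  refine ⟨⟨b, hbc, hbm, hbl⟩, ?_⟩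
  intro g hg hvol
  by_contra hcon
  push Not at hcon
  let cond : ℕ → ℕ → Prop := fun i n => ∃ l < n + 1, (g i l).1 < b n ∧ b (n + 1) < (g i l).2
  have hcc : ComputablePred fun x : ℕ × ℕ => cond x.1 x.2 := by
    apply cp_exists (p := fun (x : ℕ × ℕ) l => (g x.1 l).1 < b x.2 ∧ b (x.2 + 1) < (g x.1 l).2)
      (f := fun x => x.2 + 1) (Computable.succ.comp Computable.snd)
    have e : Computable fun x : (ℕ × ℕ) × ℕ => g x.1.1 x.2 :=
      hg.comp (Computable.fst.comp Computable.fst) Computable.snd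
    have e2 : Computable fun x : (ℕ × ℕ) × ℕ => x.1.2 := Computable.snd.comp Computable.fst
    exact cp_and (q_lt (Computable.fst.comp e) (hbc.comp e2))
      (q_lt (hbc.comp (Computable.succ.comp e2)) (Computable.snd.comp e))
  let m : ℕ → ℕ → ℚ := fun j t => ∑ n ∈ Finset.range t,
    if cond (2 * j) n then 4 ^ j * (b (n + 1) - b n) else 0
  have hterm : ∀ j n, (0 : ℚ) ≤ if cond (2 * j) n then 4 ^ j * (b (n + 1) - b n) else 0 := by
    intro j n
    have := hbm (Nat.le_succ n)
    split_ifs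
    · exact mul_nonneg (by positivity) (sub_nonneg.2 this)
    · exact le_rfl
  have hm : Computable₂ m := by
    have e : Computable fun x : (ℕ × ℕ) × ℕ => x.1.1 := Computable.fst.comp Computable.fst
    have e2 : Computable fun x : (ℕ × ℕ) × ℕ => x.2 := Computable.snd
    have e3 : Computable fun x : (ℕ × ℕ) × ℕ => (2 * x.1.1, x.2) :=
      (c_mul (Computable.const 2) e).pair e2
    have e4 : ComputablePred fun x : (ℕ × ℕ) × ℕ => cond (2 * x.1.1) x.2 := cp_comp hcc e3
    have h := q_sum (α := ℕ × ℕ) (f := fun x => x.2) Computable.snd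
      (g := fun x n => if cond (2 * x.1) n then 4 ^ x.1 * (b (n + 1) - b n) else 0)
      (c_ite e4 (q_mul (q_pow 4 e) (q_sub (hbc.comp (Computable.succ.comp e2)) (hbc.comp e2)))
        (Computable.const 0))
    exact h
  have hmm : ∀ j, Monotone (m j) := fun j => monotone_nat_of_le_succ fun t => by
    simp only [m]; rw [Finset.sum_range_succ]; linarith [hterm j t]
  have hm0 : ∀ j t, 0 ≤ m j t := fun j t => Finset.sum_nonneg fun n _ => hterm j n
  have hm1 : ∀ j t, m j t ≤ 1 := by
    intro j t
    have h1 := meas_bound hbm (V := testSet g (2 * j)) (q := (1 / 4) ^ j) (by positivity)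
      (by
        refine (hvol (2 * j)).trans (le_of_eq ?_)
        push_cast
        rw [ENNReal.ofReal_pow (by positivity), pow_mul]
        congr 1
        rw [show (1 / 4 : ℝ) = 2⁻¹ ^ 2 by norm_num, ENNReal.ofReal_pow (by positivity)]
        congr 1
        rw [ENNReal.ofReal_inv_of_pos (by norm_num)]; simp)
      ((Finset.range t).filter (cond (2 * j))) (by
        intro n hn x hx
        obtain ⟨l, -, hl1, hl2⟩ := (Finset.mem_filter.1 hn).2
        refine Set.mem_iUnion.2 ⟨l, ?_, ?_⟩
        · exact lt_of_lt_of_le (by exact_mod_cast hl1) hx.1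
        · exact lt_trans hx.2 (by exact_mod_cast hl2))
    simp only [m]
    rw [← Finset.sum_filter, ← Finset.mul_sum]
    calc _ ≤ (4 : ℚ) ^ j * (1 / 4) ^ j := by gcongr
      _ = 1 := by rw [← mul_pow]; norm_num
  obtain ⟨C, hC, hCT⟩ := hT m hm hmm hm0 hm1
  obtain ⟨j, hj⟩ := pow_unbounded_of_one_lt (C / k) (by norm_num : (1 : ℝ) < 2)
  obtain ⟨l, hl⟩ := Set.mem_iUnion.1 (hcon (2 * j))
  have hev := hbl.eventually_const_lt hl.1
  obtain ⟨N, hN⟩ := eventually_atTop.1 hev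
  let s := max N l
  have hcond : ∀ n, s ≤ n → cond (2 * j) n := by
    intro n hn
    refine ⟨l, by omega, ?_, ?_⟩
    · exact_mod_cast hN n (by omega)
    · have := (hbα (n + 1)).trans hl.2
      exact_mod_cast this
  have hinc : ∀ d, m j (s + d) - m j s = 4 ^ j * (b (s + d) - b s) := by
    intro d
    induction d with
    | zero => simp
    | succ d ih =>
      have : m j (s + (d + 1)) = m j (s + d) + 4 ^ j * (b (s + d + 1) - b (s + d)) := by
        simp only [m]
        rw [← add_assoc, Finset.sum_range_succ, if_pos (hcond (s + d) (by omega))]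
      rw [this, ← add_assoc]; linarith
  have hbd : ∀ d, (4 : ℝ) ^ j * (b (s + d) - b s) ≤ C * 2 ^ j * (Om - O s) := by
    intro d
    have h1 := hCT j s (s + d)
    have h2 : ((m j (s + d) - m j s : ℚ) : ℝ) = ((4 ^ j * (b (s + d) - b s) : ℚ) : ℝ) := by rw [hinc]
    push_cast at h2
    linarith
  have hlim : Tendsto (fun d => (4 : ℝ) ^ j * (b (s + d) - b s)) atTop (nhds (4 ^ j * (α - b s))) := by
    refine Tendsto.const_mul _ (Tendsto.sub_const ?_ _)
    have := (tendsto_add_atTop_iff_nat s).2 hbl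
    refine this.congr fun d => by rw [add_comm]
  have h1 := le_of_tendsto' hlim hbd
  have h2 := hbk s
  have h3 : 0 < Om - O s := by linarith [tfam_strict hT s]
  rw [div_lt_iff₀ hk] at hj
  have h4 : C * 2 ^ j * (Om - O s) < 4 ^ j * (k * (Om - O s)) := by
    have : (4 : ℝ) ^ j = 2 ^ j * 2 ^ j := by rw [← mul_pow]; norm_num
    rw [this]
    have := mul_lt_mul_of_pos_right hj (show 0 < 2 ^ j * (Om - O s) by positivity)
    linarith
  have h5 : (4 : ℝ) ^ j * (k * (Om - O s)) ≤ 4 ^ j * (α - b s) := by gcongr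
  linarith

end OmegaPf


namespace OmegaPf

theorem exists_lim {A : ℕ → Finset (List Bool)} (hA : Monotone A) (h1 : ∀ n, W (A n) ≤ 1) :
    ∃ l : ℝ, Tendsto (fun n => (W (A n) : ℝ)) atTop (nhds l) ∧ ∀ n, (W (A n) : ℝ) ≤ l := by
  have hm : Monotone fun n => (W (A n) : ℝ) := fun s t h => Rat.cast_le.2 (W_mono (hA h))
  have hb : BddAbove (range fun n => (W (A n) : ℝ)) :=
    ⟨1, by rintro _ ⟨n, rfl⟩; show (W (A n) : ℝ) ≤ 1; exact_mod_cast h1 n⟩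
  exact ⟨_, tendsto_atTop_ciSup hm hb, fun n => le_ciSup hb n⟩

theorem exists_stage {A : ℕ → Finset (List Bool)} (hA : Monotone A) (E : Finset (List Bool))
    (h : ∀ σ ∈ E, ∃ s, σ ∈ A s) : ∃ s, E ⊆ A s := by
  classical
  induction E using Finset.induction_on with
  | empty => exact ⟨0, by simp⟩
  | insert σ E _ ih =>
    obtain ⟨s, hs⟩ := ih fun τ hτ => h τ (Finset.mem_insert_of_mem hτ)
    obtain ⟨t, ht⟩ := h σ (Finset.mem_insert_self _ _)
    exact ⟨max s t, Finset.insert_subset (hA (le_max_right _ _) ht) (hs.trans (hA (le_max_left _ _)))⟩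

theorem hasSum_lim {A : ℕ → Finset (List Bool)} (hA : Monotone A) {T : Set (List Bool)}
    (hT : ∀ σ, σ ∈ T ↔ ∃ s, σ ∈ A s) {l : ℝ} 
    (hl : Tendsto (fun n => (W (A n) : ℝ)) atTop (nhds l)) :
    HasSum (T.indicator fun σ : List Bool => (2 : ℝ)⁻¹ ^ σ.length) l := by
  classical
  have hW : ∀ E : Finset (List Bool), (W E : ℝ) = ∑ σ ∈ E, (2 : ℝ)⁻¹ ^ σ.length := by
    intro E; simp [W, wt]
  have hm : Monotone fun n => (W (A n) : ℝ) := fun s t h => Rat.cast_le.2 (W_mono (hA h))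
  apply hasSum_of_isLUB_of_nonneg
  · intro σ; apply Set.indicator_nonneg; intro x _; positivity
  · constructor
    · rintro _ ⟨E, rfl⟩
      obtain ⟨s, hs⟩ := exists_stage hA (E.filter (· ∈ T))
        (fun σ hσ => (hT σ).1 (Finset.mem_filter.1 hσ).2)
      calc _ = ∑ σ ∈ E.filter (· ∈ T), (2 : ℝ)⁻¹ ^ σ.length := by
            rw [Finset.sum_filter]
            exact Finset.sum_congr rfl fun σ _ => by simp [Set.indicator_apply]
        _ = W (E.filter (· ∈ T)) := (hW _).symm
        _ ≤ W (A s) := Rat.cast_le.2 (W_mono hs)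
        _ ≤ l := hm.ge_of_tendsto hl s
    · intro u hu
      refine le_of_tendsto' hl fun n => ?_
      refine le_trans (le_of_eq ?_) (hu ⟨A n, rfl⟩)
      rw [hW]
      exact Finset.sum_congr rfl fun σ hσ => by
        rw [Set.indicator_of_mem ((hT σ).2 ⟨n, hσ⟩)]

theorem W_image (ρ : List Bool) (A : Finset (List Bool)) [DecidableEq (List Bool)] :
    W (A.image (ρ ++ ·)) = wt ρ * W A := by
  unfold W
  rw [Finset.sum_image (fun x _ y _ h => by simpa using h), Finset.mul_sum]
  exact Finset.sum_congr rfl fun σ _ => wt_append _ _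

theorem W_union_le (A B : Finset (List Bool)) [DecidableEq (List Bool)] :
    W (A ∪ B) ≤ W A + W B := by
  have := Finset.sum_union_inter (s₁ := A) (s₂ := B) (f := wt)
  have h := W_nonneg (A ∩ B)
  unfold W at *
  linarith

theorem wt_le_one (σ : List Bool) : wt σ ≤ 1 := pow_le_one₀ (by norm_num) (by norm_num)

theorem main {U : List Bool →. List Bool} {X : Set (List Bool)}
    (hU : UniversalPFM U) (hX : Pi01 X) (hXne : X.Nonempty) :
    LeftCE (Omega U X) ∧ MLRandom (Omega U X) := by
  classical
  obtain ⟨D⟩ := exists_dat hU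
  obtain ⟨x0, hx0⟩ := hXne
  obtain ⟨G, hGc, hGm, hGs⟩ := stage hX
  have hG : ∀ σ, σ ∉ X ↔ ∃ k, (G k σ).isSome := by
    intro σ
    have := hGs σ ()
    rw [show (() ∈ Part.assert (σ ∉ X) fun _ => Part.some ()) ↔ σ ∉ X by
      simp [Part.mem_assert_iff]] at this
    rw [this]
    exact exists_congr fun k => by
      rw [Option.isSome_iff_exists]
      exact ⟨fun h => ⟨(), h⟩, fun ⟨_, h⟩ => h⟩
  -- copy machine
  obtain ⟨ρ, hρ⟩ := univ1 hU (M := fun τ => (U τ).map fun _ => x0)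
    (hU.1.1.map (Computable.const x0).to₂) (fun σ τ h h1 h2 => hU.1.2 σ τ h h1 h2)
  set κ := wt ρ with hκ
  have hκ0 : 0 < κ := wt_pos ρ
  have hκ1 : κ ≤ 1 := wt_le_one ρ
  -- sets
  let bad : ℕ → List Bool → Prop := fun s σ => ((D.F s σ).bind (G s)).isSome
  have badc : ComputablePred fun x : ℕ × List Bool => bad x.1 x.2 := by
    have h : Computable fun x : ℕ × List Bool => (D.F x.1 x.2).bind (G x.1) :=
      Computable.option_bind D.comp (hGc.comp (Computable.fst.comp Computable.fst) Computable.snd)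
    exact ComputablePred.computable_iff.2 ⟨_, Primrec.option_isSome.to_comp.comp h, by ext; rfl⟩
  have bad_iff : ∀ s σ, bad s σ ↔ ∃ y, D.F s σ = some y ∧ (G s y).isSome := by
    intro s σ
    simp only [bad]
    cases h : D.F s σ <;> simp
  have bad_mono : ∀ s t σ, s ≤ t → bad s σ → bad t σ := by
    intro s t σ hst h
    rw [bad_iff] at *
    obtain ⟨y, h1, h2⟩ := h
    obtain ⟨z, hz⟩ := Option.isSome_iff_exists.1 h2
    exact ⟨y, D.mono _ _ _ _ hst h1, by rw [hGm _ _ _ _ hst hz]; rfl⟩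
  have F_mono : ∀ s t σ, s ≤ t → (D.F s σ).isSome → (D.F t σ).isSome := by
    intro s t σ hst h
    obtain ⟨z, hz⟩ := Option.isSome_iff_exists.1 h
    rw [D.mono _ _ _ _ hst hz]; rfl
  let Q : ℕ → Finset (List Bool) := fun s => fset s (bad s)
  have Qm : Monotone Q := fun s t h σ hσ => by
    simp only [Q, mem_fset] at *
    exact ⟨hσ.1.trans_le h, bad_mono _ _ _ h hσ.2⟩
  have QP : ∀ s, Q s ⊆ D.P s := fun s σ hσ => by
    simp only [Q, Dat.P, mem_fset] at *
    obtain ⟨y, h, -⟩ := (bad_iff _ _).1 hσ.2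
    exact ⟨hσ.1, by rw [h]; rfl⟩
  let cop : ℕ → List Bool → Prop := fun s σ => ρ ++ σ.drop ρ.length = σ ∧
    Encodable.encode (σ.drop ρ.length) < s ∧ (D.F s (σ.drop ρ.length)).isSome
  have copc : ComputablePred fun x : ℕ × List Bool => cop x.1 x.2 := by
    have hd : Computable fun x : ℕ × List Bool => x.2.drop ρ.length :=
      (Primrec.list_drop.comp (Primrec.const ρ.length) Primrec.snd).to_comp
    refine cp_and (cp_eq (Computable.list_append.comp (Computable.const ρ) hd) Computable.snd)
      (cp_and (cp_lt (Computable.encode.comp hd) Computable.fst) ?_)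
    exact ComputablePred.computable_iff.2
      ⟨_, Primrec.option_isSome.to_comp.comp (D.comp.comp Computable.fst hd), by ext; rfl⟩
  let S : ℕ → Finset (List Bool) := fun s => fset s fun σ => bad s σ ∨ ((D.F s σ).isSome ∧ cop s σ)
  have Sm : Monotone S := fun s t h σ hσ => by
    simp only [S, mem_fset] at *
    refine ⟨hσ.1.trans_le h, ?_⟩
    rcases hσ.2 with h1 | ⟨h1, h2, h3, h4⟩
    · exact Or.inl (bad_mono _ _ _ h h1)
    · exact Or.inr ⟨F_mono _ _ _ h h1, h2, h3.trans_le h, F_mono _ _ _ h h4⟩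
  have SP : ∀ s, S s ⊆ D.P s := fun s σ hσ => by
    simp only [S, mem_fset] at hσ
    rcases hσ.2 with h1 | ⟨h1, h2⟩
    · exact QP s (mem_fset.2 ⟨hσ.1, h1⟩)
    · exact mem_fset.2 ⟨hσ.1, h1⟩
  have Fc : ComputablePred fun x : ℕ × List Bool => (D.F x.1 x.2).isSome = true :=
    ComputablePred.computable_iff.2 ⟨_, Primrec.option_isSome.to_comp.comp D.comp, by ext; rfl⟩
  have Qc : Computable fun s => W (Q s) := W_fset_comp badc
  have Sc : Computable fun s => W (S s) := W_fset_comp (cp_or badc (cp_and Fc copc))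
  have P1 : ∀ s, W (D.P s) ≤ 1 := D.O_le_one hU
  obtain ⟨β, hβ, hβle⟩ := exists_lim Qm fun n => (W_mono (QP n)).trans (P1 n)
  obtain ⟨Bl, hBl, hBle⟩ := exists_lim Sm fun n => (W_mono (SP n)).trans (P1 n)
  have hO := D.O_tendsto hU
  have hOle : ∀ n, (D.O n : ℝ) ≤ D.Om := fun n =>
    (show Monotone fun n => (D.O n : ℝ) from fun s t h => Rat.cast_le.2 (D.O_mono h)).ge_of_tendsto hO n
  -- relations
  have up : ∀ s, W (S s) ≤ W (Q s) + κ * D.O s := by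
    intro s
    have : S s ⊆ Q s ∪ (D.P s).image (ρ ++ ·) := by
      intro σ hσ
      simp only [S, mem_fset] at hσ
      rcases hσ.2 with h1 | ⟨h1, h2, h3, h4⟩
      · exact Finset.mem_union_left _ (mem_fset.2 ⟨hσ.1, h1⟩)
      · exact Finset.mem_union_right _ (Finset.mem_image.2 ⟨_, mem_fset.2 ⟨h3, h4⟩, h2⟩)
    exact (W_mono this).trans ((W_union_le _ _).trans (by rw [W_image]; rfl))
  have low : ∀ s, W (Q s) + κ * D.O s ≤ Bl := by
    intro s
    obtain ⟨t, ht⟩ := exists_stage D.P_mono ((D.P s).image (ρ ++ ·)) (by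
      intro σ hσ
      obtain ⟨τ, hτ, rfl⟩ := Finset.mem_image.1 hσ
      apply D.mem_of_dom
      rw [hρ]
      exact D.dom_of_mem hτ)
    have hd : Disjoint (Q s) ((D.P s).image (ρ ++ ·)) := by
      rw [Finset.disjoint_left]
      intro σ h1 h2
      obtain ⟨τ, hτ, rfl⟩ := Finset.mem_image.1 h2
      obtain ⟨y, hy, hy2⟩ := (bad_iff _ _).1 (mem_fset.1 h1).2
      have : y ∈ U (ρ ++ τ) := (D.spec _ _).2 ⟨_, hy⟩
      rw [hρ] at this
      obtain ⟨_, _, rfl⟩ := (Part.mem_map_iff _).1 this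
      exact (hG _).2 ⟨_, hy2⟩ hx0
    have hsub : Q s ∪ (D.P s).image (ρ ++ ·) ⊆ S (max s t) := by
      apply Finset.union_subset
      · intro σ hσ
        have := Qm (le_max_left s t) hσ
        simp only [S, Q, mem_fset] at *
        exact ⟨this.1, Or.inl this.2⟩
      · intro σ hσ
        have h1 := D.P_mono (le_max_right s t) (ht hσ)
        obtain ⟨τ, hτ, rfl⟩ := Finset.mem_image.1 hσ
        have h2 := D.P_mono (le_max_left s t) hτ
        simp only [S, Dat.P, mem_fset, cop, List.drop_left] at *
        exact ⟨h1.1, Or.inr ⟨h1.2, trivial, h2⟩⟩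
    have h3 := W_mono hsub
    rw [W_union hd, W_image] at h3
    refine le_trans ?_ (hBle (max s t))
    exact_mod_cast h3
  have low' : β + κ * D.Om ≤ Bl :=
    le_of_tendsto' (hβ.add (hO.const_mul (κ : ℝ))) low
  -- value of Omega
  have hOmega : Omega U X = D.Om - β := by
    have h1 := hasSum_lim D.P_mono (T := {σ | (U σ).Dom})
      (fun σ => ⟨fun h => D.mem_of_dom h, fun ⟨s, h⟩ => D.dom_of_mem h⟩) hO
    have h2 := hasSum_lim Qm (T := {σ | ∃ y ∈ U σ, y ∉ X}) (fun σ => by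
      constructor
      · rintro ⟨y, hy, hyX⟩
        obtain ⟨k, hk⟩ := (D.spec _ _).1 hy
        obtain ⟨l, hl⟩ := (hG _).1 hyX
        obtain ⟨z, hz⟩ := Option.isSome_iff_exists.1 hl
        refine ⟨max (max k l) (Encodable.encode σ + 1), mem_fset.2 ⟨by omega, (bad_iff _ _).2 ⟨y, ?_, ?_⟩⟩⟩
        · exact D.mono k _ _ _ (by omega) hk
        · rw [hGm l _ _ _ (by omega) hz]; rfl
      · rintro ⟨s, hs⟩
        obtain ⟨y, hy, hy2⟩ := (bad_iff _ _).1 (mem_fset.1 hs).2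
        exact ⟨y, (D.spec _ _).2 ⟨_, hy⟩, (hG _).2 ⟨_, hy2⟩⟩) hβ
    have h3 := h1.sub h2
    have h4 : HasSum (({σ | ∃ y ∈ U σ, y ∈ X} : Set (List Bool)).indicator
        fun σ : List Bool => (2 : ℝ)⁻¹ ^ σ.length) (D.Om - β) := by
      refine Eq.mpr (congrArg (fun f => HasSum f (D.Om - β)) (funext fun σ => ?_)) h3
      simp only [Set.indicator_apply, Set.mem_setOf_eq]
      by_cases hdom : (U σ).Dom
      · obtain ⟨y, hy⟩ := Part.dom_iff_mem.1 hdom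
        have e : ∀ p : List Bool → Prop, (∃ z ∈ U σ, p z) ↔ p y := fun p =>
          ⟨fun ⟨z, hz, hp⟩ => Part.mem_unique hz hy ▸ hp, fun h => ⟨y, hy, h⟩⟩
        simp only [e, hdom]
        by_cases hyX : y ∈ X <;> simp [hyX]
      · have e : ∀ p : List Bool → Prop, ¬ (∃ z ∈ U σ, p z) := fun p ⟨z, hz, _⟩ =>
          hdom (Part.dom_iff_mem.2 ⟨z, hz⟩)
        simp only [e, hdom]
        simp
    exact (hasSum_subtype_iff_indicator.2 h4).tsum_eq
  rw [hOmega]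
  -- dichotomy
  have hκr0 : (0 : ℝ) < κ := by exact_mod_cast hκ0
  have hκr1 : (κ : ℝ) ≤ 1 := by exact_mod_cast hκ1
  have hT := tfam hU D
  rcases dichotomy (d := (1 + κ / 16) / (1 + κ / 2)) (r := 1 + κ / 16) D.O_comp Sc D.O_mono
    (fun s t h => W_mono (Sm h)) D.O_nonneg (D.O_le_one hU) hO hBl hT (by positivity) (by linarith)
    with h | h
  · obtain ⟨s0, hs0⟩ := eventually_atTop.1 h
    refine finish (a := fun n => D.O (n + s0) - W (Q (n + s0))) (O := fun n => D.O (n + s0)) (k := κ / 2)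
      (Om := D.Om)
      ?_ ?_ (fun s t h => D.O_mono (by omega)) (by positivity) ?_ (tfam_shift hT s0)
    · have e : Computable fun n : ℕ => n + s0 := c_add Computable.id (Computable.const s0)
      exact q_sub (D.O_comp.comp e) (Qc.comp e)
    · have := (tendsto_add_atTop_iff_nat s0).2 (hO.sub hβ)
      refine this.congr fun n => by push_cast; rfl
    · intro n
      have h1 := hs0 (n + s0) (by omega)
      have h2 : ((W (S (n + s0)) : ℚ) : ℝ) ≤ W (Q (n + s0)) + κ * D.O (n + s0) := by
        exact_mod_cast up (n + s0)
      push_cast at h1 ⊢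
      have hr : (0 : ℝ) < 1 + κ / 16 := by positivity
      have hd : (0 : ℝ) < 1 + κ / 2 := by positivity
      rw [div_mul_eq_mul_div, div_le_iff₀ hd, mul_assoc, mul_le_mul_iff_right₀ hr] at h1
      nlinarith
  · exfalso
    obtain ⟨s0, hs0⟩ := eventually_atTop.1 h
    obtain ⟨p, hp⟩ := exists_nat_gt (8 / (κ : ℝ))
    have hp0 : (0 : ℝ) < p := lt_trans (by positivity) hp
    refine game (a := fun n => D.O (n + s0) - W (S (n + s0))) (c0 := s0) (p := p)
      (P := fun n => D.P (n + s0)) (S := fun n => S (n + s0)) (α := D.Om - Bl) (Om := D.Om)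
      (fun s t h => D.P_mono (by omega)) (fun s t h => Sm (by omega)) (fun n => SP _)
      (fun n => card_fset _ _) (fun n => P1 _) (fun n => rfl) ?_ ?_ (tfam_shift hT s0)
      (by exact_mod_cast hp0) ?_
    · have e : Computable fun n : ℕ => n + s0 := c_add Computable.id (Computable.const s0)
      exact q_sub (D.O_comp.comp e) (Sc.comp e)
    · have := (tendsto_add_atTop_iff_nat s0).2 (hO.sub hBl)
      refine this.congr fun n => by push_cast; rfl
    · intro n
      have h1 := hs0 (n + s0) (by omega)
      have h2 := hOle (n + s0)
      push_cast at h1 ⊢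
      change 1 / (p : ℝ) * (D.Om - D.O (n + s0)) ≤ _
      have hd : (0 : ℝ) < 1 + κ / 2 := by positivity
      have hb : (1 / (p : ℝ)) ≤ κ / 8 := by
        rw [div_lt_iff₀ hκr0] at hp
        rw [div_le_iff₀ hp0]; linarith
      set x := D.Om - D.O (n + s0) with hx
      set y := Bl - W (S (n + s0)) with hy
      have hx0 : 0 ≤ x := by linarith
      have hy0 : 0 ≤ y := by linarith [hBle (n + s0)]
      have h3 : (1 + κ / 2 : ℝ) * x ≤ (1 + κ / 16) ^ 2 * y := by
        rw [← mul_assoc, mul_div_assoc', div_mul_eq_mul_div, le_div_iff₀ hd] at h1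
        linarith
      have h4 : (1 + κ / 16 : ℝ) ^ 2 ≤ 1 + κ / 4 := by nlinarith
      have h5 : (1 + κ / 2 : ℝ) * x ≤ (1 + κ / 4) * y := h3.trans (by gcongr)
      have h6 : (1 + κ / 8 : ℝ) * x ≤ y := by
        by_contra hc
        push Not at hc
        have : (1 + κ / 4 : ℝ) * y < (1 + κ / 4) * ((1 + κ / 8) * x) := by gcongr
        nlinarith [mul_nonneg hκr0.le hx0, mul_nonneg (mul_nonneg hκr0.le hx0) (sub_nonneg.2 hκr1)]
      have h7 : 1 / (p : ℝ) * x ≤ κ / 8 * x := by gcongr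
      linarith

end OmegaPf

/-- If `U` is a universal prefix-free machine and `X` is a nonempty Π⁰₁ set, then
`Ω_U(X)` is a Martin-Löf random left-c.e. real. -/
theorem omega_pi01_leftCE_random (U : List Bool →. List Bool) (X : Set (List Bool))
    (hU : UniversalPFM U) (hX : Pi01 X) (hXne : X.Nonempty) :
    LeftCE (Omega U X) ∧ MLRandom (Omega U X) := by
  exact OmegaPf.main hU hX hXne
end

section
/- For any Martin-Löf random left-c.e. reals α and β, D(α,β) = D*(α,β). -/
open Filter MeasureTheory Set

/-- `DD α β` is the infimum of the positive rationals `q` such that `qα - β` is a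
left-c.e. real. -/
noncomputable def DD (a b : ℝ) : ℝ :=
  sInf {x : ℝ | ∃ q : ℚ, 0 < q ∧ x = (q : ℝ) ∧ LeftCE ((q : ℝ) * a - b)}

/-- `DDstar α β` is the supremum of the positive rationals `q` such that `qα - β` is a
right-c.e. real. -/
noncomputable def DDstar (a b : ℝ) : ℝ :=
  sSup {x : ℝ | ∃ q : ℚ, 0 < q ∧ x = (q : ℝ) ∧ RightCE ((q : ℝ) * a - b)}


/-- raw code -/
def rawE (q : ℚ) : ℕ := @Encodable.encode ℚ Rat.instEncodable q

def rawP (n : ℕ) : Prop := 0 < n.unpair.2 ∧ Nat.Coprime ((n.unpair.1 + 1) / 2) n.unpair.2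

instance : DecidablePred rawP := fun n => by unfold rawP; infer_instance

def zc (z : ℤ) : ℕ := Equiv.intEquivNat z

lemma rawE_eq (q : ℚ) : rawE q = Nat.pair (zc q.num) q.den := by
  cases q; rfl

lemma zc_ofNat (n : ℕ) : zc (Int.ofNat n) = 2 * n := rfl
lemma zc_negSucc (n : ℕ) : zc (Int.negSucc n) = 2 * n + 1 := rfl

lemma zc_natAbs (z : ℤ) : (zc z + 1) / 2 = z.natAbs := by
  cases z with
  | ofNat n => rw [zc_ofNat]; simp; omega
  | negSucc n => rw [zc_negSucc]; simp; omega

lemma zc_surj (n : ℕ) : ∃ z, zc z = n := Equiv.intEquivNat.surjective n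

lemma rawP_iff (n : ℕ) : rawP n ↔ n ∈ Set.range rawE := by
  constructor
  · rintro ⟨h1, h2⟩
    obtain ⟨z, hz⟩ := zc_surj n.unpair.1
    rw [← hz, zc_natAbs] at h2
    refine ⟨⟨z, n.unpair.2, h1.ne', h2⟩, ?_⟩
    rw [rawE_eq]
    simp only [hz, Nat.pair_unpair]
  · rintro ⟨q, rfl⟩
    rw [rawE_eq]
    unfold rawP
    simp only [Nat.unpair_pair, zc_natAbs]
    exact ⟨q.den_pos, q.reduced⟩

/-- the code used by `Computable` on the rationals -/
def dE (q : ℚ) : ℕ := @Encodable.encode ℚ (Primcodable.ofDenumerable ℚ).toEncodable q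

lemma ofNat_dE (q : ℚ) : Denumerable.ofNat ℚ (dE q) = q :=
  @Denumerable.ofNat_encode ℚ Rat.instDenumerable q

lemma dE_ofNat (n : ℕ) : dE (Denumerable.ofNat ℚ n) = n :=
  @Denumerable.encode_ofNat ℚ Rat.instDenumerable n

lemma dE_prim : Primrec dE := Primrec.encode

lemma enc_eq (q : ℚ) : dE q = Nat.count rawP (rawE q) := by
  have h1 : dE q = @List.countP ℕ (fun x => @decide (x ∈ Set.range (@Encodable.encode ℚ Rat.instEncodable)) (@Encodable.decidableRangeEncode ℚ Rat.instEncodable x)) (List.range (rawE q)) := rfl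
  rw [h1, Nat.count_eq_card_filter_range, List.countP_eq_length_filter]
  rw [Finset.card_def, Finset.filter_val]
  simp only [Finset.range_val, Multiset.range, Multiset.filter_coe, Multiset.coe_card]
  congr 2
  funext x
  simp only [decide_eq_decide, rawP_iff]
  rfl

lemma rawP_prim : PrimrecPred rawP := by
  have hd : PrimrecRel (fun a b : ℕ => b ∣ a) := by
    have : PrimrecRel (fun a b : ℕ => a % b = 0) :=
      Primrec.eq.comp₂ Primrec.nat_mod (Primrec₂.const 0)
    exact this.of_eq fun a b => by rw [Nat.dvd_iff_mod_eq_zero]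
  have hR : PrimrecRel (fun (k : ℕ) (n : ℕ) => ¬ (1 < k ∧ k ∣ (n.unpair.1+1)/2 ∧ k ∣ n.unpair.2)) := by
    apply PrimrecPred.not
    apply PrimrecPred.and
    · exact Primrec.nat_lt.comp (Primrec.const 1) Primrec.fst
    apply PrimrecPred.and
    · refine hd.comp ?_ Primrec.fst
      exact Primrec.nat_div.comp (Primrec.succ.comp (Primrec.fst.comp (Primrec.unpair.comp Primrec.snd))) (Primrec.const 2)
    · refine hd.comp ?_ Primrec.fst
      exact (Primrec.snd.comp (Primrec.unpair.comp Primrec.snd)) 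
  have hA := PrimrecRel.forall_lt hR
  have h2 : Primrec (fun n : ℕ => n.unpair.2) := Primrec.snd.comp Primrec.unpair
  have hB : PrimrecPred (fun n : ℕ => ∀ x < n.unpair.2 + 1, ¬ (1 < x ∧ x ∣ (n.unpair.1+1)/2 ∧ x ∣ n.unpair.2)) :=
    hA.comp (Primrec.succ.comp h2) Primrec.id
  have hC : PrimrecPred (fun n : ℕ => 0 < n.unpair.2) := Primrec.nat_lt.comp (Primrec.const 0) h2
  refine (hC.and hB).of_eq fun n => ?_
  unfold rawP
  refine and_congr_right fun hpos => ?_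
  constructor
  · intro h
    by_contra hn
    refine h (Nat.gcd ((n.unpair.1+1)/2) n.unpair.2) ?_ ⟨?_, Nat.gcd_dvd_left _ _, Nat.gcd_dvd_right _ _⟩
    · exact Nat.lt_succ_of_le (Nat.gcd_le_right _ hpos)
    · have : 0 < Nat.gcd ((n.unpair.1+1)/2) n.unpair.2 := Nat.gcd_pos_of_pos_right _ hpos
      unfold Nat.Coprime at hn
      omega
  · rintro h x - ⟨hx, h1, h2⟩
    have := Nat.eq_one_of_dvd_coprimes h h1 h2
    omega

lemma count_prim : Primrec (Nat.count rawP) := by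
  have hs : Primrec₂ (fun (n : ℕ) (r : ℕ) => r + if rawP n then 1 else 0) := by
    refine Primrec.nat_add.comp Primrec.snd ?_
    exact Primrec.ite (rawP_prim.comp Primrec.fst) (Primrec.const 1) (Primrec.const 0)
  refine (Primrec.nat_rec₁ 0 hs).of_eq fun n => ?_
  induction n with
  | zero => simp
  | succ n ih => rw [Nat.count_succ, ← ih]

/-- the raw code is computable -/
lemma rawE_comp : Computable rawE := by
  have hp : Computable₂ (fun (q : ℚ) (n : ℕ) => (decide (rawP n) && decide (Nat.count rawP n = dE q))) := by
    apply Primrec₂.to_comp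
    refine Primrec.and.comp ?_ ?_
    · exact (rawP_prim.comp Primrec.snd).decide
    · exact PrimrecPred.decide (Primrec.eq.comp (count_prim.comp Primrec.snd) (dE_prim.comp Primrec.fst))
  have := Partrec.rfind (p := fun (q : ℚ) (n : ℕ) => Part.some (decide (rawP n) && decide (Nat.count rawP n = dE q))) hp
  refine this.of_eq_tot fun q => ?_
  refine Nat.mem_rfind.2 ⟨?_, ?_⟩
  · have := (rawP_iff (rawE q)).2 ⟨q, rfl⟩
    simp [this, enc_eq]
  · intro m hm
    simp only [Part.mem_some_iff, enc_eq]
    symm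
    rw [Bool.and_eq_false_iff]
    by_cases h : rawP m
    · right
      simp only [decide_eq_false_iff_not]
      exact ((Nat.count_strict_mono h hm)).ne
    · left; simpa using h

lemma den_comp : Computable (fun q : ℚ => q.den) := by
  have : Computable (fun q => (rawE q).unpair.2) := Computable.snd.comp (Computable.unpair.comp rawE_comp)
  exact this.of_eq fun q => by simp [rawE_eq]

lemma zc_comp : Computable (fun q : ℚ => zc q.num) := by
  have : Computable (fun q => (rawE q).unpair.1) := Computable.fst.comp (Computable.unpair.comp rawE_comp)
  exact this.of_eq fun q => by simp [rawE_eq]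

def zpos (n : ℕ) : ℕ := if n % 2 = 0 then n / 2 else 0
def zneg (n : ℕ) : ℕ := if n % 2 = 0 then 0 else (n + 1) / 2

lemma zpos_prim : Primrec zpos := by
  refine Primrec.ite ?_ ?_ (Primrec.const 0)
  · exact Primrec.eq.comp (Primrec.nat_mod.comp Primrec.id (Primrec.const 2)) (Primrec.const 0)
  · exact Primrec.nat_div.comp Primrec.id (Primrec.const 2)

lemma zneg_prim : Primrec zneg := by
  refine Primrec.ite ?_ (Primrec.const 0) ?_
  · exact Primrec.eq.comp (Primrec.nat_mod.comp Primrec.id (Primrec.const 2)) (Primrec.const 0)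
  · exact Primrec.nat_div.comp Primrec.succ (Primrec.const 2)

lemma zpn (z : ℤ) : z = (zpos (zc z) : ℤ) - zneg (zc z) := by
  cases z with
  | ofNat n => rw [zc_ofNat]; simp [zpos, zneg]
  | negSucc n => 
    rw [zc_negSucc]; simp [zpos, zneg]
    have : (2 * n + 1) % 2 = 1 := by omega
    omega

def qA (q : ℚ) : ℕ := zpos (zc q.num)
def qB (q : ℚ) : ℕ := zneg (zc q.num)

lemma qA_comp : Computable qA := zpos_prim.to_comp.comp zc_comp
lemma qB_comp : Computable qB := zneg_prim.to_comp.comp zc_comp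

lemma q_eq (q : ℚ) : q = ((qA q : ℚ) - qB q) / q.den := by
  have := zpn q.num
  have h2 : (q.num : ℚ) = (qA q : ℚ) - qB q := by
    rw [this]; push_cast; rfl
  rw [← h2, Rat.num_div_den]

section
variable {α : Type*} [Primcodable α]

lemma cadd {f g : α → ℕ} (hf : Computable f) (hg : Computable g) : Computable (fun x => f x + g x) :=
  (Primrec.nat_add.to_comp).comp hf hg
lemma cmul {f g : α → ℕ} (hf : Computable f) (hg : Computable g) : Computable (fun x => f x * g x) :=
  (Primrec.nat_mul.to_comp).comp hf hg

lemma comp_of_frac {g : α → ℚ} {a b d : α → ℕ} (ha : Computable a) (hb : Computable b)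
    (hd : Computable d) (hpos : ∀ x, 0 < d x) (h : ∀ x, g x = ((a x : ℚ) - b x) / d x) :
    Computable g := by
  have hof : Computable (fun k : ℕ => Denumerable.ofNat ℚ k) := Computable.ofNat ℚ
  have hk : Computable (fun p : α × ℕ => Denumerable.ofNat ℚ p.2) := hof.comp Computable.snd
  have hp : Computable₂ (fun (x : α) (k : ℕ) => decide
      (qA (Denumerable.ofNat ℚ k) * d x + b x * (Denumerable.ofNat ℚ k).den
        = a x * (Denumerable.ofNat ℚ k).den + qB (Denumerable.ofNat ℚ k) * d x)) := by
    have heq : Computable₂ (fun m n : ℕ => decide (m = n)) := (Primrec.eq (α := ℕ)).decide.to_comp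
    refine heq.comp (cadd (cmul (qA_comp.comp hk) (hd.comp Computable.fst)) 
      (cmul (hb.comp Computable.fst) (den_comp.comp hk)))
      (cadd (cmul (ha.comp Computable.fst) (den_comp.comp hk)) (cmul (qB_comp.comp hk) (hd.comp Computable.fst)))
  have key : ∀ x (q : ℚ), (qA q * d x + b x * q.den = a x * q.den + qB q * d x) ↔ q = g x := by
    intro x q
    have h1 : (0:ℚ) < d x := by exact_mod_cast hpos x
    have h2 : (0:ℚ) < q.den := by exact_mod_cast q.den_pos
    rw [h x]
    conv_rhs => rw [q_eq q]
    rw [div_eq_div_iff h2.ne' h1.ne', ← Nat.cast_inj (R := ℚ)]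
    push_cast
    constructor <;> intro h <;> linarith
  have hp' : Partrec₂ (fun (x : α) (k : ℕ) => Part.some (decide
      (qA (Denumerable.ofNat ℚ k) * d x + b x * (Denumerable.ofNat ℚ k).den
        = a x * (Denumerable.ofNat ℚ k).den + qB (Denumerable.ofNat ℚ k) * d x))) := hp
  have hr := (Partrec.rfind hp').map (g := fun _ k => Denumerable.ofNat ℚ k) (hof.comp Computable.snd)
  refine hr.of_eq_tot fun x => ?_
  rw [Part.mem_map_iff]
  refine ⟨dE (g x), ?_, ofNat_dE _⟩
  refine Nat.mem_rfind.2 ⟨?_, ?_⟩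
  · simp only [Part.mem_some_iff]
    symm
    rw [decide_eq_true_iff, key, ofNat_dE]
  · intro m hm
    simp only [Part.mem_some_iff]
    symm
    rw [decide_eq_false_iff_not, key]
    intro hc
    rw [← hc, dE_ofNat] at hm
    exact lt_irrefl _ hm

lemma qadd {f g : α → ℚ} (hf : Computable f) (hg : Computable g) : Computable (fun x => f x + g x) := by
  have fA := qA_comp.comp hf
  have fB := qB_comp.comp hf
  have fD := den_comp.comp hf
  have gA := qA_comp.comp hg
  have gB := qB_comp.comp hg
  have gD := den_comp.comp hg
  refine comp_of_frac (cadd (cmul fA gD) (cmul gA fD)) (cadd (cmul fB gD) (cmul gB fD)) (cmul fD gD)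
    (fun x => Nat.mul_pos (f x).den_pos (g x).den_pos) fun x => ?_
  conv_lhs => rw [q_eq (f x), q_eq (g x)]
  have h1 : ((f x).den : ℚ) ≠ 0 := by exact_mod_cast (f x).den_nz
  have h2 : ((g x).den : ℚ) ≠ 0 := by exact_mod_cast (g x).den_nz
  push_cast
  field_simp
  ring

lemma qmul {f g : α → ℚ} (hf : Computable f) (hg : Computable g) : Computable (fun x => f x * g x) := by
  have fA := qA_comp.comp hf
  have fB := qB_comp.comp hf
  have fD := den_comp.comp hf
  have gA := qA_comp.comp hg
  have gB := qB_comp.comp hg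
  have gD := den_comp.comp hg
  refine comp_of_frac (cadd (cmul fA gA) (cmul fB gB)) (cadd (cmul fA gB) (cmul fB gA)) (cmul fD gD)
    (fun x => Nat.mul_pos (f x).den_pos (g x).den_pos) fun x => ?_
  conv_lhs => rw [q_eq (f x), q_eq (g x)]
  have h1 : ((f x).den : ℚ) ≠ 0 := by exact_mod_cast (f x).den_nz
  have h2 : ((g x).den : ℚ) ≠ 0 := by exact_mod_cast (g x).den_nz
  push_cast
  field_simp
  ring

lemma qneg {f : α → ℚ} (hf : Computable f) : Computable (fun x => - f x) :=
  (qmul (Computable.const (-1)) hf).of_eq fun x => by ring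

lemma qsub {f g : α → ℚ} (hf : Computable f) (hg : Computable g) : Computable (fun x => f x - g x) :=
  (qadd hf (qneg hg)).of_eq fun x => by ring

lemma qlt {f g : α → ℚ} (hf : Computable f) (hg : Computable g) :
    Computable (fun x => decide (f x < g x)) := by
  have fA := qA_comp.comp hf
  have fB := qB_comp.comp hf
  have fD := den_comp.comp hf
  have gA := qA_comp.comp hg
  have gB := qB_comp.comp hg
  have gD := den_comp.comp hg
  have hlt : Computable₂ (fun m n : ℕ => decide (m < n)) := Primrec.nat_lt.decide.to_comp
  refine (hlt.comp (cadd (cmul fA gD) (cmul gB fD)) (cadd (cmul gA fD) (cmul fB gD))).of_eq fun x => ?_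
  rw [decide_eq_decide]
  conv_rhs => rw [q_eq (f x), q_eq (g x)]
  have h1 : (0:ℚ) < ((f x).den : ℚ) := by exact_mod_cast (f x).den_pos
  have h2 : (0:ℚ) < ((g x).den : ℚ) := by exact_mod_cast (g x).den_pos
  rw [div_lt_div_iff₀ h1 h2, ← Nat.cast_lt (α := ℚ)]
  push_cast
  constructor <;> intro h <;> linarith

lemma citeb {c : α → Prop} [DecidablePred c] {σ : Type*} [Primcodable σ] {f g : α → σ}
    (hc : Computable (fun x => decide (c x))) (hf : Computable f) (hg : Computable g) :
    Computable (fun x => if c x then f x else g x) :=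
  (Computable.cond hc hf hg).of_eq fun x => by by_cases h : c x <;> simp [h]

end

/-- first argmax of `φ` on `[s,t]` -/
def amax (φ : ℕ → ℚ) (s t : ℕ) : ℕ :=
  Nat.rec (motive := fun _ => ℕ) s (fun j r => if s ≤ j ∧ φ r < φ (j + 1) then j + 1 else r) t

lemma amax_succ (φ : ℕ → ℚ) (s t : ℕ) : amax φ s (t + 1) =
    if s ≤ t ∧ φ (amax φ s t) < φ (t + 1) then t + 1 else amax φ s t := rfl

lemma amax_of_le (φ : ℕ → ℚ) (s t : ℕ) (h : t ≤ s) : amax φ s t = s := by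
  induction t with
  | zero => rfl
  | succ t ih => rw [amax_succ, if_neg (by omega), ih (by omega)]

lemma amax_ge (φ : ℕ → ℚ) (s t : ℕ) : s ≤ amax φ s t := by
  induction t with
  | zero => exact le_rfl
  | succ t ih => rw [amax_succ]; split_ifs <;> omega

lemma amax_le (φ : ℕ → ℚ) (s t : ℕ) (h : s ≤ t) : amax φ s t ≤ t := by
  induction t with
  | zero => exact h
  | succ t ih =>
    rcases Nat.lt_or_ge t s with h1 | h1
    · rw [amax_of_le _ _ _ (by omega)]; exact h
    · have := ih h1
      rw [amax_succ]; split_ifs <;> omega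

lemma amax_mono (φ : ℕ → ℚ) (s : ℕ) : Monotone (fun t => φ (amax φ s t)) := by
  refine monotone_nat_of_le_succ fun t => ?_
  simp only [amax_succ]
  split_ifs with h
  · exact h.2.le
  · exact le_rfl

lemma amax_spec (φ : ℕ → ℚ) (s t r : ℕ) (h1 : s ≤ r) (h2 : r ≤ t) : φ r ≤ φ (amax φ s t) := by
  have h : φ r ≤ φ (amax φ s r) := by
    cases r with
    | zero => rw [amax_of_le _ _ _ (by omega)]; rw [show s = 0 by omega]
    | succ r =>
      rcases Nat.lt_or_ge r s with h3 | h3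
      · rw [amax_of_le _ _ _ (by omega)]; rw [show s = r + 1 by omega]
      · rw [amax_succ]
        split_ifs with h4
        · exact le_rfl
        · push Not at h4; exact h4 h3
  exact h.trans (amax_mono φ s h2)

lemma amax_const (φ : ℕ → ℚ) (s T t : ℕ) (h0 : s ≤ T) (h1 : amax φ s T ≤ t) (h2 : t ≤ T) :
    amax φ s t = amax φ s T := by
  induction T with
  | zero => rw [show t = 0 by omega]
  | succ T ih =>
    rcases Nat.lt_or_ge T s with h3 | h3
    · have := amax_of_le φ s (T+1) (by omega)
      rw [show t = T + 1 by omega]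
    · rcases Nat.lt_or_ge T t with h4 | h4
      · rw [show t = T + 1 by omega]
      · rw [amax_succ] at h1 ⊢
        split_ifs at h1 ⊢ with h5
        · omega
        · exact ih h3 h1 h4

lemma amax_comp {α : Type*} [Primcodable α] {φ : ℕ → ℚ} (hφ : Computable φ) {f g : α → ℕ}
    (hf : Computable f) (hg : Computable g) : Computable (fun x => amax φ (f x) (g x)) := by
  refine Computable.nat_rec (h := fun x (p : ℕ × ℕ) =>
    if f x ≤ p.1 ∧ φ p.2 < φ (p.1 + 1) then p.1 + 1 else p.2) hg hf ?_
  have h1 : Computable (fun y : α × (ℕ × ℕ) => y.2.1) := Computable.fst.comp Computable.snd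
  have h2 : Computable (fun y : α × (ℕ × ℕ) => y.2.2) := Computable.snd.comp Computable.snd
  have h3 : Computable (fun y : α × (ℕ × ℕ) => f y.1) := hf.comp Computable.fst
  have h1' : Computable (fun y : α × (ℕ × ℕ) => y.2.1 + 1) := Computable.succ.comp h1
  have hle : Computable₂ (fun m n : ℕ => decide (m ≤ n)) := Primrec.nat_le.decide.to_comp
  have hand : Computable₂ (fun a b : Bool => a && b) := Primrec.and.to_comp
  have hc : Computable (fun y : α × (ℕ × ℕ) => decide (f y.1 ≤ y.2.1 ∧ φ y.2.2 < φ (y.2.1 + 1))) :=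
    (hand.comp (hle.comp h3 h1) (qlt (hφ.comp h2) (hφ.comp h1'))).of_eq fun y => by
      rw [Bool.decide_and]
  exact citeb hc h1' h2

lemma step_meas (φ : ℕ → ℚ) (E : ℕ → ℕ → Set ℝ) (γ : ℕ → ℝ) (hγ : Monotone γ) (ρ : ℝ) (hρ : 0 ≤ ρ)
    (H : ∀ s T, s ≤ T → (∀ t, s ≤ t → t ≤ T → φ t ≤ φ s) →
      volume (⋃ t ∈ Icc s T, E s t) ≤ ENNReal.ofReal (ρ * (γ T - γ s))) (s T : ℕ) (hsT : s ≤ T) :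
    volume (⋃ t ∈ Icc s T, E (amax φ s t) t) ≤ ENNReal.ofReal (ρ * (γ T - γ s)) := by
  induction T using Nat.strong_induction_on with
  | _ T ih =>
    obtain ⟨u, hu⟩ : ∃ u, u = amax φ s T := ⟨_, rfl⟩
    have hus : s ≤ u := hu ▸ amax_ge φ s T
    have huT : u ≤ T := hu ▸ amax_le φ s T hsT
    have hmax : ∀ t, u ≤ t → t ≤ T → φ t ≤ φ u := fun t h1 h2 => by
      rw [hu]; exact amax_spec φ s T t (hus.trans h1) h2
    have hu1 := H u T huT hmax
    have hconst : ∀ t, u ≤ t → t ≤ T → amax φ s t = u := fun t h1 h2 => by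
      rw [hu]; exact amax_const φ s T t hsT (hu ▸ h1) h2
    rcases Nat.eq_or_lt_of_le hus with h | h
    · subst h
      refine le_trans (measure_mono ?_) hu1
      refine iUnion₂_mono fun t ht => ?_
      rw [hconst t ht.1 ht.2]
    · have h1 := ih (u - 1) (by omega) (by omega)
      have hsub : (⋃ t ∈ Icc s T, E (amax φ s t) t) ⊆
          (⋃ t ∈ Icc s (u-1), E (amax φ s t) t) ∪ (⋃ t ∈ Icc u T, E u t) := by
        intro x hx
        simp only [mem_iUnion, mem_union, mem_Icc] at hx ⊢
        obtain ⟨t, ⟨ht1, ht2⟩, hx⟩ := hx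
        rcases Nat.lt_or_ge t u with h3 | h3
        · left; exact ⟨t, ⟨ht1, by omega⟩, hx⟩
        · right; refine ⟨t, ⟨h3, ht2⟩, ?_⟩
          rwa [hconst t h3 ht2] at hx
      refine (measure_mono hsub).trans ((measure_union_le _ _).trans ((add_le_add h1 hu1).trans ?_))
      have e1 : γ s ≤ γ (u-1) := hγ (by omega)
      have e2 : γ (u-1) ≤ γ u := hγ (by omega)
      have e3 : γ u ≤ γ T := hγ huT
      rw [← ENNReal.ofReal_add (mul_nonneg hρ (by linarith)) (mul_nonneg hρ (by linarith))]
      refine ENNReal.ofReal_le_ofReal ?_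
      nlinarith

section main
variable (a b : ℕ → ℚ) (p q : ℚ)

def phP (n : ℕ) : ℚ := b n - p * a n
def phQ (n : ℕ) : ℚ := q * a n - b n

def WW (k s t : ℕ) : ℕ :=
  amax (phQ a b q) ((fun r => amax (phP a b p) (amax (phQ a b q) r t) t)^[k] s) t

def E0 (s t : ℕ) : Set ℝ := Ioo ((a s : ℚ) : ℝ) ((a s + (b t - b s) * q⁻¹ : ℚ) : ℝ)

lemma WW_bound (ha : Monotone a) (hb : Monotone b) (hp : 0 < p) (hq : 0 < q) (k s T : ℕ) (hsT : s ≤ T) :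
    volume (⋃ t ∈ Icc s T, E0 a b q (WW a b p q k s t) t) ≤
      ENNReal.ofReal (((q:ℝ)⁻¹ * (p / q) ^ k) * ((b T : ℝ) - b s)) := by
  have hp' : (0:ℝ) < p := by exact_mod_cast hp
  have hq' : (0:ℝ) < q := by exact_mod_cast hq
  have ha' : Monotone (fun n => (a n : ℝ)) := fun i j h => by simpa using ha h
  have hb' : Monotone (fun n => (b n : ℝ)) := fun i j h => by simpa using hb h
  induction k generalizing s T with
  | zero =>
    refine step_meas (phQ a b q) (E0 a b q) (fun n => (b n : ℝ)) hb' _ (by positivity) ?_ s T hsT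
    intro s T hsT _
    have : (⋃ t ∈ Icc s T, E0 a b q s t) ⊆ E0 a b q s T := by
      refine iUnion₂_subset fun t ht => ?_
      refine Ioo_subset_Ioo_right ?_
      have := hb ht.2
      have h2 : 0 < q⁻¹ := inv_pos.2 hq
      exact_mod_cast (by nlinarith : a s + (b t - b s) * q⁻¹ ≤ a s + (b T - b s) * q⁻¹)
    refine (measure_mono this).trans ?_
    rw [E0, Real.volume_Ioo]
    refine ENNReal.ofReal_le_ofReal (le_of_eq ?_)
    push_cast
    ring
  | succ k ih =>
    have hF : ∀ s T, s ≤ T → volume (⋃ t ∈ Icc s T,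
        (fun s t => E0 a b q (WW a b p q k s t) t) (amax (phP a b p) s t) t) ≤
        ENNReal.ofReal ((((q:ℝ)⁻¹ * (p / q) ^ k) * p) * ((a T : ℝ) - a s)) := by
      refine step_meas (phP a b p) (fun s t => E0 a b q (WW a b p q k s t) t) (fun n => (a n : ℝ)) ha' _
        (by positivity) ?_
      intro s T hsT hmax
      refine (ih s T hsT).trans (ENNReal.ofReal_le_ofReal ?_)
      rw [mul_assoc _ (p:ℝ)]
      refine mul_le_mul_of_nonneg_left ?_ (by positivity)
      have := hmax T hsT le_rfl
      unfold phP at this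
      have : b T - b s ≤ p * (a T - a s) := by linarith
      exact_mod_cast this
    refine step_meas (phQ a b q) (fun s t => E0 a b q (WW a b p q k (amax (phP a b p) s t) t) t)
      (fun n => (b n : ℝ)) hb' _ (by positivity) ?_ s T hsT
    intro s T hsT hmax
    refine (hF s T hsT).trans (ENNReal.ofReal_le_ofReal ?_)
    have := hmax T hsT le_rfl
    unfold phQ at this
    have : q * (a T - a s) ≤ b T - b s := by linarith
    have : (q : ℝ) * (a T - a s) ≤ b T - b s := by exact_mod_cast this
    have h3 : (q:ℝ)⁻¹ * (p / q) ^ (k+1) * ((b T : ℝ) - b s) 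
       = ((q:ℝ)⁻¹ * (p / q) ^ k * p) * ((b T - b s) / q) := by rw [pow_succ]; ring
    rw [h3]
    refine mul_le_mul_of_nonneg_left ?_ (by positivity)
    rw [le_div_iff₀ hq']
    linarith

lemma amax_lim (φ : ℕ → ℚ) (x : ℝ) (hx : Tendsto (fun n => (φ n : ℝ)) atTop (nhds x)) (s : ℕ)
    (hs : ∃ r ≥ s, x < φ r) :
    ∃ u ≥ s, x < φ u ∧ ∀ᶠ t in atTop, amax φ s t = u := by
  obtain ⟨r, hr, hxr⟩ := hs
  obtain ⟨N, hN⟩ := eventually_atTop.1 (hx.eventually (gt_mem_nhds hxr))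
  obtain ⟨M, hM⟩ : ∃ M, M = max N r := ⟨_, rfl⟩
  refine ⟨amax φ s M, amax_ge _ _ _, ?_, ?_⟩
  · have := amax_spec φ s M r hr (by omega)
    have : (φ r : ℝ) ≤ φ (amax φ s M) := by exact_mod_cast this
    linarith
  · filter_upwards [eventually_ge_atTop M] with t ht
    induction t, ht using Nat.le_induction with
    | base => rfl
    | succ t ht ih =>
      rw [amax_succ, if_neg, ih]
      rintro ⟨-, h⟩
      rw [ih] at h
      have h1 := amax_spec φ s M r hr (by omega)
      have h2 : (φ (t+1) : ℝ) < φ r := hN (t+1) (by omega)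
      have h2' : φ (t+1) < φ r := by exact_mod_cast h2
      linarith

lemma WW_lim {x y : ℝ} (hx : Tendsto (fun n => (phP a b p n : ℝ)) atTop (nhds x))
    (hy : Tendsto (fun n => (phQ a b q n : ℝ)) atTop (nhds y))
    (hsx : ∀ s, ∃ r ≥ s, x < phP a b p r) (hsy : ∀ s, ∃ r ≥ s, y < phQ a b q r) (k s : ℕ) :
    ∃ u, y < phQ a b q u ∧ ∀ᶠ t in atTop, WW a b p q k s t = u := by
  induction k generalizing s with
  | zero => 
    obtain ⟨u, -, h1, h2⟩ := amax_lim _ y hy s (hsy s)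
    exact ⟨u, h1, h2⟩
  | succ k ih =>
    obtain ⟨u, -, -, h2⟩ := amax_lim _ y hy s (hsy s)
    obtain ⟨v, -, -, h3⟩ := amax_lim _ x hx u (hsx u)
    obtain ⟨w, hw, h4⟩ := ih v
    refine ⟨w, hw, ?_⟩
    filter_upwards [h2, h3, h4] with t e2 e3 e4
    rw [← e4, ← e3, ← e2]
    rfl

lemma ph_comp (ha : Computable a) (hb : Computable b) (p q : ℚ) : 
    Computable (phP a b p) ∧ Computable (phQ a b q) :=
  ⟨qsub hb (qmul (Computable.const p) ha), qsub (qmul (Computable.const q) ha) hb⟩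

lemma WW_comp (ha : Computable a) (hb : Computable b) {α : Type*} [Primcodable α] {f g : α → ℕ}
    (hf : Computable f) (hg : Computable g) : Computable (fun x => WW a b p q (f x) 0 (g x)) := by
  obtain ⟨hP, hQ⟩ := ph_comp a b ha hb p q
  refine amax_comp hQ ?_ hg
  have : Computable (fun x : α => Nat.rec (motive := fun _ => ℕ) 0 (fun _ r => 
      amax (phP a b p) (amax (phQ a b q) r (g x)) (g x)) (f x)) := by
    refine Computable.nat_rec (h := fun x (y : ℕ × ℕ) => 
      amax (phP a b p) (amax (phQ a b q) y.2 (g x)) (g x)) hf (Computable.const 0) ?_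
    have h1 : Computable (fun y : α × (ℕ × ℕ) => y.2.2) := Computable.snd.comp Computable.snd
    have h2 : Computable (fun y : α × (ℕ × ℕ) => g y.1) := hg.comp Computable.fst
    exact amax_comp hP (amax_comp hQ h1 h2) h2
  refine this.of_eq fun x => ?_
  generalize f x = k
  induction k with
  | zero => rfl
  | succ k ih => rw [Function.iterate_succ_apply', ← ih]

lemma vol_iUnion_le (S : ℕ → Set ℝ) (C : ENNReal) (h : ∀ T, volume (⋃ t ∈ Icc 0 T, S t) ≤ C) :
    volume (⋃ t, S t) ≤ C := by
  have : (⋃ t, S t) = ⋃ T, ⋃ t ∈ Icc 0 T, S t := by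
    ext x; simp only [mem_iUnion, mem_Icc]
    exact ⟨fun ⟨t, ht⟩ => ⟨t, t, ⟨by omega, le_rfl⟩, ht⟩, fun ⟨_, t, _, ht⟩ => ⟨t, ht⟩⟩
  rw [this, Monotone.measure_iUnion]
  · exact iSup_le h
  · intro i j hij
    exact biUnion_subset_biUnion_left (Icc_subset_Icc_right hij)

end main

lemma not_random_of_both {x : ℝ} (hl : LeftCE x) (hr : RightCE x) : ¬ MLRandom x := by
  obtain ⟨l, hlc, hlm, hlt⟩ := hl
  obtain ⟨r, hrc, hrm, hrt⟩ := hr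
  intro h
  have lx : ∀ n, (l n : ℝ) ≤ x := fun n =>
    (show Monotone (fun n => (l n : ℝ)) from fun i j h => by simpa using hlm h).ge_of_tendsto hlt n
  have xr : ∀ n, x ≤ (r n : ℝ) := fun n =>
    (show Antitone (fun n => (r n : ℝ)) from fun i j h => by simpa using hrm h).le_of_tendsto hrt n
  obtain ⟨ε, hε, hεc⟩ : ∃ ε : ℕ → ℚ, (∀ i, ε i = (1/8) * (1/2)^i) ∧ Computable ε := by
    refine ⟨fun i => Nat.rec (motive := fun _ => ℚ) (1/8) (fun _ e => e * (1/2)) i, ?_, ?_⟩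
    · intro i
      induction i with
      | zero => simp
      | succ i ih => rw [pow_succ, ← mul_assoc, ← ih]
    · refine Computable.nat_rec (h := fun _ (y : ℕ × ℚ) => y.2 * (1/2)) Computable.id
        (Computable.const _) ?_
      exact qmul (Computable.snd.comp Computable.snd) (Computable.const _)
  have hεpos : ∀ i, 0 < ε i := fun i => by rw [hε]; positivity
  let g : ℕ → ℕ → ℚ × ℚ := fun i n => if (r n - l n : ℚ) < (ε i : ℚ) then ((l n - ε i : ℚ), (r n + ε i : ℚ)) else ((0 : ℚ), (0 : ℚ))
  have hg : Computable₂ g := by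
    have e := hεc.comp (Computable.fst (α := ℕ) (β := ℕ))
    have l' := hlc.comp (Computable.snd (α := ℕ) (β := ℕ))
    have r' := hrc.comp (Computable.snd (α := ℕ) (β := ℕ))
    exact citeb (qlt (qsub r' l') e) (Computable.pair (qsub l' e) (qadd r' e)) (Computable.const _)
  obtain ⟨i, hi⟩ := h g hg (fun i => by
    have hsub : testSet g i ⊆ Ioo (x - 4 * ε i) (x + 4 * ε i) := by
      refine iUnion_subset fun n => ?_
      simp only [g]
      split_ifs with hc
      · have hc' : (r n : ℝ) - l n < ε i := by exact_mod_cast hc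
        have h0 : (0:ℝ) < ε i := by exact_mod_cast hεpos i
        have := lx n
        have := xr n
        push_cast
        exact Ioo_subset_Ioo (by linarith) (by linarith)
      · simp
    refine (measure_mono hsub).trans ?_
    rw [Real.volume_Ioo, show x + 4 * (ε i : ℝ) - (x - 4 * ε i) = (2⁻¹)^i by rw [hε]; push_cast; ring,
      ENNReal.ofReal_pow (by norm_num), ENNReal.ofReal_inv_of_pos (by norm_num)]
    simp)
  apply hi
  have ht : Tendsto (fun n => (r n : ℝ) - l n) atTop (nhds 0) := by simpa using hrt.sub hlt
  have h0 : (0:ℝ) < ε i := by exact_mod_cast hεpos i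
  obtain ⟨n, hn⟩ := (ht.eventually (gt_mem_nhds h0)).exists
  refine mem_iUnion.2 ⟨n, ?_⟩
  have hn' : r n - l n < ε i := by exact_mod_cast hn
  simp only [g, if_pos hn']
  have := lx n
  have := xr n
  push_cast
  exact ⟨by linarith, by linarith⟩

lemma not_random_rat (r : ℚ) : ¬ MLRandom (r : ℝ) :=
  not_random_of_both ⟨fun _ => r, Computable.const r, monotone_const, tendsto_const_nhds⟩
    ⟨fun _ => r, Computable.const r, antitone_const, tendsto_const_nhds⟩

lemma leftCE_of_eventually {φ : ℕ → ℚ} (hφ : Computable φ) {x : ℝ}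
    (hx : Tendsto (fun n => (φ n : ℝ)) atTop (nhds x)) (h : ¬ ∀ s, ∃ r ≥ s, x < φ r) : LeftCE x := by
  push Not at h
  obtain ⟨N, hN⟩ := h
  refine ⟨fun t => φ (amax φ N t), hφ.comp (amax_comp hφ (Computable.const N) Computable.id),
    amax_mono φ N, ?_⟩
  refine tendsto_of_tendsto_of_tendsto_of_le_of_le' hx tendsto_const_nhds ?_ ?_
  · filter_upwards [eventually_ge_atTop N] with t ht
    exact_mod_cast amax_spec φ N t t ht le_rfl
  · exact Eventually.of_forall fun t => hN _ (amax_ge _ _ _)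

lemma rightCE_of_neg {x : ℝ} (h : LeftCE (-x)) : RightCE x := by
  obtain ⟨f, h1, h2, h3⟩ := h
  refine ⟨fun n => - f n, qneg h1, fun i j h => neg_le_neg (h2 h), ?_⟩
  have := h3.neg
  simpa using this

lemma key_dichotomy {a b : ℝ} (ha : LeftCE a) (har : MLRandom a) (hb : LeftCE b) {p q : ℚ}
    (hp : 0 < p) (hpq : p < q) : RightCE ((p : ℝ) * a - b) ∨ LeftCE ((q : ℝ) * a - b) := by
  obtain ⟨A, hAc, hAm, hAt⟩ := ha
  obtain ⟨B, hBc, hBm, hBt⟩ := hb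
  have hq : 0 < q := hp.trans hpq
  have hp' : (0:ℝ) < p := by exact_mod_cast hp
  have hq' : (0:ℝ) < q := by exact_mod_cast hq
  have hpq' : (p:ℝ) < q := by exact_mod_cast hpq
  obtain ⟨hPc, hQc⟩ := ph_comp A B hAc hBc p q
  have hPt : Tendsto (fun n => (phP A B p n : ℝ)) atTop (nhds (b - p * a)) := by
    have := hBt.sub (hAt.const_mul (p:ℝ))
    simpa [phP] using this
  have hQt : Tendsto (fun n => (phQ A B q n : ℝ)) atTop (nhds (q * a - b)) := by
    have := (hAt.const_mul (q:ℝ)).sub hBt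
    simpa [phQ] using this
  by_contra hcon
  push Not at hcon
  obtain ⟨hc1, hc2⟩ := hcon
  have hsx : ∀ s, ∃ r ≥ s, b - p * a < phP A B p r := by
    by_contra h
    exact hc1 (rightCE_of_neg (by rw [neg_sub]; exact leftCE_of_eventually hPc hPt h))
  have hsy : ∀ s, ∃ r ≥ s, q * a - b < phQ A B q r := by
    by_contra h
    exact hc2 (leftCE_of_eventually hQc hQt h)
  have Aa : ∀ n, (A n : ℝ) < a := fun n => by
    have h1 : (A n : ℝ) ≤ a :=
      (show Monotone (fun n => (A n : ℝ)) from fun i j h => by simpa using hAm h).ge_of_tendsto hAt n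
    refine lt_of_le_of_ne h1 fun h => ?_
    rw [← h] at har
    exact not_random_rat _ har
  have Bb : ∀ n, (B n : ℝ) ≤ b := fun n => 
      (show Monotone (fun n => (B n : ℝ)) from fun i j h => by simpa using hBm h).ge_of_tendsto hBt n
  have hlt : (p / q : ℝ) < 1 := by rwa [div_lt_one hq']
  obtain ⟨m, hm⟩ := exists_pow_lt_of_lt_one (show (0:ℝ) < 2⁻¹ by norm_num) hlt
  have hC0 : 0 ≤ b - B 0 := by linarith [Bb 0]
  obtain ⟨m0, hm0⟩ := exists_pow_lt_of_lt_one (show (0:ℝ) < ((q:ℝ)⁻¹ * (b - B 0) + 1)⁻¹ by positivity) hlt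
  let g : ℕ → ℕ → ℚ × ℚ := fun i n =>
    (A (WW A B p q (m * i + m0) 0 n), A (WW A B p q (m * i + m0) 0 n) +
      (B n - B (WW A B p q (m * i + m0) 0 n)) * q⁻¹)
  have hg : Computable₂ g := by
    have hk : Computable (fun y : ℕ × ℕ => m * y.1 + m0) :=
      cadd (cmul (Computable.const m) Computable.fst) (Computable.const m0)
    have hW := WW_comp A B p q hAc hBc hk Computable.snd
    exact Computable.pair (hAc.comp hW) (qadd (hAc.comp hW) 
      (qmul (qsub (hBc.comp Computable.snd) (hBc.comp hW)) (Computable.const _)))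
  obtain ⟨i, hi⟩ := har g hg (fun i => by
    refine vol_iUnion_le _ _ fun T => ?_
    refine (WW_bound A B p q hAm hBm hp hq (m * i + m0) 0 T (Nat.zero_le _)).trans ?_
    rw [show (2⁻¹ : ENNReal) ^ i = ENNReal.ofReal (2⁻¹ ^ i) by
      rw [ENNReal.ofReal_pow (by norm_num), ENNReal.ofReal_inv_of_pos (by norm_num)]; simp]
    refine ENNReal.ofReal_le_ofReal ?_
    have h1 : ((p / q : ℝ) ^ m) ^ i ≤ 2⁻¹ ^ i := pow_le_pow_left₀ (by positivity) hm.le i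
    have h2 : (q:ℝ)⁻¹ * (b - B 0) * (p / q : ℝ) ^ m0 ≤ 1 := by
      have hX : 0 ≤ (q:ℝ)⁻¹ * (b - B 0) := by positivity
      have h3 : (p / q : ℝ) ^ m0 * ((q:ℝ)⁻¹ * (b - B 0) + 1) ≤ 1 := by
        rw [← le_div_iff₀ (by positivity), one_div]; exact hm0.le
      have : (0:ℝ) ≤ (p / q : ℝ) ^ m0 := by positivity
      nlinarith
    have h4 : (B T : ℝ) - B 0 ≤ b - B 0 := by linarith [Bb T]
    calc (q:ℝ)⁻¹ * (p / q) ^ (m * i + m0) * ((B T : ℝ) - B 0) 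
        ≤ (q:ℝ)⁻¹ * (p / q) ^ (m * i + m0) * (b - B 0) := 
          mul_le_mul_of_nonneg_left h4 (by positivity)
      _ = ((p / q : ℝ) ^ m) ^ i * ((q:ℝ)⁻¹ * (b - B 0) * (p / q : ℝ) ^ m0) := by
          rw [pow_add, pow_mul]; ring
      _ ≤ ((p / q : ℝ) ^ m) ^ i * 1 := mul_le_mul_of_nonneg_left h2 (by positivity)
      _ ≤ 2⁻¹ ^ i := by rw [mul_one]; exact h1)
  apply hi
  obtain ⟨u, hu, hev⟩ := WW_lim A B p q hPt hQt hsx hsy (m * i + m0) 0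
  have hu' : (q:ℝ) * a - b < q * A u - B u := by
    have : ((phQ A B q u : ℚ) : ℝ) = q * A u - B u := by simp [phQ]
    rwa [this] at hu
  have hlim : ∀ᶠ t in atTop, (q:ℝ) * a - q * A u + B u < B t := 
    hBt.eventually (lt_mem_nhds (by linarith))
  obtain ⟨t, ht1, ht2⟩ := (hev.and hlim).exists
  refine mem_iUnion.2 ⟨t, ?_⟩
  simp only [g, ht1]
  refine ⟨Aa u, ?_⟩
  push_cast
  have : a - A u < (B t - B u) * (q:ℝ)⁻¹ := by
    rw [← div_eq_mul_inv, lt_div_iff₀ hq']; linarith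
  linarith

lemma no_overlap {a b : ℝ} (ha : LeftCE a) (har : MLRandom a) {p q : ℚ}
    (h1 : RightCE ((q : ℝ) * a - b)) (h2 : LeftCE ((p : ℝ) * a - b)) : q ≤ p := by
  by_contra hlt
  push Not at hlt
  obtain ⟨f, f1, f2, f3⟩ := h1
  obtain ⟨g, g1, g2, g3⟩ := h2
  have hpos : 0 < (q - p)⁻¹ := inv_pos.2 (by linarith)
  have hne : (q:ℝ) - p ≠ 0 := by
    have : (p:ℝ) < q := by exact_mod_cast hlt
    linarith
  refine not_random_of_both ha ⟨fun n => (f n - g n) * (q - p)⁻¹, 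
    qmul (qsub f1 g1) (Computable.const _), ?_, ?_⟩ har
  · intro i j hij
    have := f2 hij
    have := g2 hij
    exact mul_le_mul_of_nonneg_right (by linarith) hpos.le
  · have := (f3.sub g3).mul_const (((q:ℝ) - p)⁻¹)
    have e : ((q : ℝ) * a - b - (p * a - b)) * ((q:ℝ) - p)⁻¹ = a := by
      field_simp; ring
    rw [e] at this
    simpa using this

/-- For any Martin-Löf random left-c.e. reals `α` and `β`, `D(α,β) = D*(α,β)`. -/
theorem D_eq_Dstar (a b : ℝ) (ha : LeftCE a) (har : MLRandom a)
    (hb : LeftCE b) (hbr : MLRandom b) :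
    DD a b = DDstar a b := by
  unfold DD DDstar
  set SA := {x : ℝ | ∃ q : ℚ, 0 < q ∧ x = (q : ℝ) ∧ LeftCE ((q : ℝ) * a - b)} with hSA
  set SB := {x : ℝ | ∃ q : ℚ, 0 < q ∧ x = (q : ℝ) ∧ RightCE ((q : ℝ) * a - b)} with hSB
  have hbelow : BddBelow SA := ⟨0, by rintro x ⟨q, hq, rfl, -⟩; exact_mod_cast hq.le⟩
  have hle : ∀ x ∈ SB, ∀ y ∈ SA, x ≤ y := by
    rintro x ⟨q, -, rfl, h1⟩ y ⟨p, -, rfl, h2⟩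
    exact_mod_cast no_overlap ha har h1 h2
  have hdi : ∀ p q : ℚ, 0 < p → p < q → (p : ℝ) ∈ SB ∨ (q : ℝ) ∈ SA := fun p q h1 h2 =>
    (key_dichotomy ha har hb h1 h2).imp (fun h => ⟨p, h1, rfl, h⟩) (fun h => ⟨q, h1.trans h2, rfl, h⟩)
  rcases SA.eq_empty_or_nonempty with hA | hA
  · have : ¬ BddAbove SB := by
      rintro ⟨M, hM⟩
      obtain ⟨n, hn⟩ := exists_nat_gt (max M 0)
      have hn0 : (0:ℝ) < n := (le_max_right _ _).trans_lt hn
      have hn0' : (0:ℚ) < n := by exact_mod_cast hn0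
      rcases hdi n (n+1) hn0' (by linarith) with h | h
      · have := hM h
        push_cast at this
        linarith [le_max_left M 0]
      · rw [hA] at h; exact h
    rw [hA, Real.sInf_empty, Real.sSup_of_not_bddAbove this]
  · obtain ⟨y0, hy0⟩ := hA
    have hA : SA.Nonempty := ⟨y0, hy0⟩
    have habove : BddAbove SB := ⟨y0, fun x hx => hle x hx y0 hy0⟩
    have hA0 : 0 ≤ sInf SA := Real.sInf_nonneg (by rintro x ⟨q, hq, rfl, -⟩; exact_mod_cast hq.le)
    have hB0 : 0 ≤ sSup SB := Real.sSup_nonneg (by rintro x ⟨q, hq, rfl, -⟩; exact_mod_cast hq.le)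
    apply le_antisymm
    · by_contra hlt
      push Not at hlt
      obtain ⟨p, hp1, hp2⟩ := exists_rat_btwn hlt
      obtain ⟨q, hq1, hq2⟩ := exists_rat_btwn hp2
      have hp0 : 0 < p := by exact_mod_cast hB0.trans_lt hp1
      rcases hdi p q hp0 (by exact_mod_cast hq1) with h | h
      · linarith [le_csSup habove h]
      · linarith [csInf_le hbelow h]
    · refine Real.sSup_le (fun x hx => le_csInf hA fun y hy => hle x hx y hy) hA0
end
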